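/- arXiv:1102.2774 — 12 statements merged into one kernel-verified Lean document; each statement's English description precedes it below -/
import Mathlib

section
/- Let t be a fixed real number and, for i = 1,2,3,4, let a_i and b_i be real-valued functions that are continuous on an open interval containing t and three times differentiable in a neighborhood of t. For δ > 0 set ã_i(δ) = ∫_{t−δ}^{t+δ} a_i(x) dx and b̃_i(δ) = ∫_{t−δ}^{t+δ} b_i(x) dx. If a_1(t)a_2(t) = a_3(t)a_4(t) and b_1(t)b_2(t) = b_3(t)b_4(t), but b_1''(t)b_2(t) + b_1(t)b_2''(t) − b_3''(t)b_4(t) − b_3(t)b_4''(t) ≠ 0, then as δ → 0⁺ the ratio (ã_1(δ)ã_2(δ) − ã_3(δ)ã_4(δ)) / (b̃_1(δ)b̃_2(δ) − b̃_3(δ)b̃_4(δ)) converges to (a_1''(t)a_2(t) + a_1(t)a_2''(t) − a_3''(t)a_4(t) − a_3(t)a_4''(t)) / (b_1''(t)b_2(t) + b_1(t)b_2''(t) − b_3''(t)b_4(t) − b_3(t)b_4''(t)). -/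
open Topology Filter intervalIntegral

/-- Third order expansion of the symmetric integral. -/
lemma key_expansion (t : ℝ) (f f' f'' f''' : ℝ → ℝ) (u : Set ℝ) (hu : u ∈ 𝓝 t)
    (h : ∀ x ∈ u, HasDerivAt f (f' x) x ∧ HasDerivAt f' (f'' x) x ∧
        HasDerivAt f'' (f''' x) x) :
    Tendsto (fun δ : ℝ => ((∫ x in (t - δ)..(t + δ), f x) - 2 * δ * f t) / δ ^ 3)
      (𝓝[>] (0 : ℝ)) (𝓝 (f'' t / 3)) := by
  obtain ⟨ε, hε, hball⟩ := Metric.mem_nhds_iff.1 hu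
  have hI : Metric.ball t ε = Set.Ioo (t - ε) (t + ε) := Real.ball_eq_Ioo t ε
  rw [hI] at hball
  have hcont : ContinuousOn f (Set.Ioo (t - ε) (t + ε)) := fun x hx =>
    (h x (hball hx)).1.continuousAt.continuousWithinAt
  have ht : t ∈ Set.Ioo (t - ε) (t + ε) := ⟨by linarith, by linarith⟩
  have hint : ∀ x ∈ Set.Ioo (t - ε) (t + ε), ∀ y ∈ Set.Ioo (t - ε) (t + ε),
      IntervalIntegrable f MeasureTheory.volume x y := fun x hx y hy =>
    (hcont.mono (Set.ordConnected_Ioo.uIcc_subset hx hy)).intervalIntegrable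
  have hF : ∀ y ∈ Set.Ioo (t - ε) (t + ε),
      HasDerivAt (fun y => ∫ x in t..y, f x) (f y) y := fun y hy =>
    integral_hasDerivAt_right (hint t ht y hy)
      (hcont.stronglyMeasurableAtFilter isOpen_Ioo y hy)
      (h y (hball hy)).1.continuousAt
  have hev0 : ∀ᶠ δ : ℝ in 𝓝 0, t + δ ∈ Set.Ioo (t - ε) (t + ε) ∧
      t - δ ∈ Set.Ioo (t - ε) (t + ε) := by
    filter_upwards [Ioo_mem_nhds (neg_lt_zero.2 hε) hε] with δ hδ
    exact ⟨⟨by linarith [hδ.1], by linarith [hδ.2]⟩, ⟨by linarith [hδ.2], by linarith [hδ.1]⟩⟩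
  have hev : ∀ᶠ δ : ℝ in 𝓝[>] 0, t + δ ∈ Set.Ioo (t - ε) (t + ε) ∧
      t - δ ∈ Set.Ioo (t - ε) (t + ε) := hev0.filter_mono nhdsWithin_le_nhds
  have hpos : ∀ᶠ δ : ℝ in 𝓝[>] 0, 0 < δ := eventually_mem_nhdsWithin
  have hp : ∀ δ : ℝ, HasDerivAt (fun δ => t + δ) 1 δ := fun δ => (hasDerivAt_id δ).const_add t
  have hm : ∀ δ : ℝ, HasDerivAt (fun δ => t - δ) (-1) δ := fun δ => (hasDerivAt_id δ).const_sub t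
  -- continuity of the symmetric combinations
  have hlim : ∀ (g : ℝ → ℝ), ContinuousAt g t →
      Tendsto (fun δ => g (t + δ)) (𝓝[>] 0) (𝓝 (g t)) ∧
      Tendsto (fun δ => g (t - δ)) (𝓝[>] 0) (𝓝 (g t)) := by
    intro g hg
    constructor
    · refine hg.tendsto.comp (Tendsto.mono_left ?_ nhdsWithin_le_nhds)
      simpa using (hp 0).continuousAt.tendsto
    · refine hg.tendsto.comp (Tendsto.mono_left ?_ nhdsWithin_le_nhds)
      simpa using (hm 0).continuousAt.tendsto
  have hz : ∀ (g : ℝ → ℝ), Continuous g → g 0 = 0 → Tendsto g (𝓝[>] 0) (𝓝 0) := by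
    intro g hg h0
    have := hg.tendsto 0
    rw [h0] at this
    exact this.mono_left nhdsWithin_le_nhds
  obtain ⟨hf1, hf2, hf3⟩ := h t (hball ht)
  have s3 : Tendsto (fun δ : ℝ => (f'' (t + δ) + f'' (t - δ)) / 6) (𝓝[>] 0) (𝓝 (f'' t / 3)) := by
    obtain ⟨h1, h2⟩ := hlim f'' hf3.continuousAt
    have := (h1.add h2).div_const 6
    convert this using 2
    ring
  have s2 : Tendsto (fun δ : ℝ => (f' (t + δ) - f' (t - δ)) / (6 * δ)) (𝓝[>] 0)
      (𝓝 (f'' t / 3)) := by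
    refine HasDerivAt.lhopital_zero_nhdsGT (f' := fun δ => f'' (t + δ) + f'' (t - δ))
      (g' := fun _ => 6) ?_ ?_ ?_ ?_ ?_ s3
    · filter_upwards [hev] with δ hδ
      have h1 := (h _ (hball hδ.1)).2.1.comp δ (hp δ)
      have h2 := (h _ (hball hδ.2)).2.1.comp δ (hm δ)
      refine HasDerivAt.congr_deriv (h1.sub h2) ?_
      ring
    · filter_upwards with δ
      simpa using (hasDerivAt_id δ).const_mul 6
    · filter_upwards with δ
      norm_num
    · obtain ⟨h1, h2⟩ := hlim f' hf2.continuousAt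
      simpa using h1.sub h2
    · exact hz _ (by fun_prop) (by simp)
  have s1 : Tendsto (fun δ : ℝ => (f (t + δ) + f (t - δ) - 2 * f t) / (3 * δ ^ 2)) (𝓝[>] 0)
      (𝓝 (f'' t / 3)) := by
    refine HasDerivAt.lhopital_zero_nhdsGT (f' := fun δ => f' (t + δ) - f' (t - δ))
      (g' := fun δ => 6 * δ) ?_ ?_ ?_ ?_ ?_ s2
    · filter_upwards [hev] with δ hδ
      have h1 := (h _ (hball hδ.1)).1.comp δ (hp δ)
      have h2 := (h _ (hball hδ.2)).1.comp δ (hm δ)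
      refine HasDerivAt.congr_deriv ((h1.add h2).sub_const (2 * f t)) ?_
      ring
    · filter_upwards with δ
      refine HasDerivAt.congr_deriv ((hasDerivAt_pow 2 δ).const_mul 3) ?_
      norm_num
      ring
    · filter_upwards [hpos] with δ hδ
      positivity
    · obtain ⟨h1, h2⟩ := hlim f hf1.continuousAt
      have := (h1.add h2).sub_const (2 * f t)
      convert this using 2
      ring
    · exact hz _ (by fun_prop) (by simp)
  have s0 : Tendsto (fun δ : ℝ => ((∫ x in t..(t + δ), f x) - (∫ x in t..(t - δ), f x)
      - 2 * δ * f t) / (δ ^ 3)) (𝓝[>] 0) (𝓝 (f'' t / 3)) := by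
    refine HasDerivAt.lhopital_zero_nhdsGT (f' := fun δ => f (t + δ) + f (t - δ) - 2 * f t)
      (g' := fun δ => 3 * δ ^ 2) ?_ ?_ ?_ ?_ ?_ s1
    · filter_upwards [hev] with δ hδ
      have h1 := (hF _ hδ.1).comp δ (hp δ)
      have h2 := (hF _ hδ.2).comp δ (hm δ)
      have h3 := ((hasDerivAt_id δ).const_mul 2).mul_const (f t)
      refine HasDerivAt.congr_deriv ((h1.sub h2).sub h3) ?_
      ring
    · filter_upwards with δ
      refine HasDerivAt.congr_deriv ((hasDerivAt_pow 3 δ)) ?_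
      norm_num
    · filter_upwards [hpos] with δ hδ
      positivity
    · obtain ⟨h1, h2⟩ := hlim _ (hF t ht).continuousAt
      have h3 := hz (fun δ => 2 * δ * f t) (by fun_prop) (by simp)
      simpa using (h1.sub h2).sub h3
    · exact hz _ (by fun_prop) (by simp)
  refine s0.congr' ?_
  filter_upwards [hev] with δ hδ
  rw [integral_interval_sub_left (hint t ht _ hδ.1) (hint t ht _ hδ.2)]

lemma key_product (t : ℝ) (a a' a'' a''' : Fin 4 → ℝ → ℝ) (u : Set ℝ) (hu : u ∈ 𝓝 t)
    (hadiff : ∀ i, ∀ x ∈ u,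
      HasDerivAt (a i) (a' i x) x ∧ HasDerivAt (a' i) (a'' i x) x ∧
        HasDerivAt (a'' i) (a''' i x) x)
    (ha0 : a 0 t * a 1 t = a 2 t * a 3 t) :
    Tendsto (fun δ : ℝ =>
        ((∫ x in (t - δ)..(t + δ), a 0 x) * (∫ x in (t - δ)..(t + δ), a 1 x) -
          (∫ x in (t - δ)..(t + δ), a 2 x) * (∫ x in (t - δ)..(t + δ), a 3 x)) / δ ^ 4)
      (𝓝[>] (0 : ℝ))
      (𝓝 (2 / 3 * (a'' 0 t * a 1 t + a 0 t * a'' 1 t - a'' 2 t * a 3 t - a 2 t * a'' 3 t))) := by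
  have H := fun i => key_expansion t (a i) (a' i) (a'' i) (a''' i) u hu (hadiff i)
  have hd : Tendsto (fun δ : ℝ => δ ^ 2) (𝓝[>] (0 : ℝ)) (𝓝 0) := by
    have : Tendsto (fun δ : ℝ => δ ^ 2) (𝓝 (0 : ℝ)) (𝓝 (0 ^ 2)) := (continuous_pow 2).tendsto 0
    simpa using this.mono_left nhdsWithin_le_nhds
  have T := ((((H 0).mul_const (2 * a 1 t)).add ((H 1).mul_const (2 * a 0 t))).sub
    (((H 2).mul_const (2 * a 3 t)).add ((H 3).mul_const (2 * a 2 t)))).add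
    (hd.mul (((H 0).mul (H 1)).sub ((H 2).mul (H 3))))
  have T' := T.congr' (f₂ := fun δ : ℝ =>
        ((∫ x in (t - δ)..(t + δ), a 0 x) * (∫ x in (t - δ)..(t + δ), a 1 x) -
          (∫ x in (t - δ)..(t + δ), a 2 x) * (∫ x in (t - δ)..(t + δ), a 3 x)) / δ ^ 4) ?_
  · convert T' using 2
    ring
  · filter_upwards [eventually_mem_nhdsWithin] with δ hδ
    have hδ' : δ ≠ 0 := ne_of_gt hδ
    generalize (∫ x in (t - δ)..(t + δ), a 0 x) = A0
    generalize (∫ x in (t - δ)..(t + δ), a 1 x) = A1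
    generalize (∫ x in (t - δ)..(t + δ), a 2 x) = A2
    generalize (∫ x in (t - δ)..(t + δ), a 3 x) = A3
    field_simp
    linear_combination (-4 * δ ^ 2) * ha0

/-- Lemma 1 of Nicolae, Meng and Kong: if `a i` and `b i` (`i = 1,…,4`)
are continuous on an open interval containing `t` and three times differentiable in a
neighborhood of `t`, with `a 1 t * a 2 t = a 3 t * a 4 t`, `b 1 t * b 2 t = b 3 t * b 4 t`
but `b₁'' b₂ + b₁ b₂'' − b₃'' b₄ − b₃ b₄'' ≠ 0` at `t`, then as `δ → 0⁺` the ratio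
`(ã₁ã₂ − ã₃ã₄)/(b̃₁b̃₂ − b̃₃b̃₄)` of products of the integrals
`ã_i(δ) = ∫_{t−δ}^{t+δ} a_i`, `b̃_i(δ) = ∫_{t−δ}^{t+δ} b_i` converges to
`(a₁''a₂ + a₁a₂'' − a₃''a₄ − a₃a₄'')/(b₁''b₂ + b₁b₂'' − b₃''b₄ − b₃b₄'')` at `t`. -/
theorem stmt_0 (t lo hi : ℝ) (hlo : lo < t) (hhi : t < hi)
    (a b a' b' a'' b'' a''' b''' : Fin 4 → ℝ → ℝ)
    (hacont : ∀ i, ContinuousOn (a i) (Set.Ioo lo hi))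
    (hbcont : ∀ i, ContinuousOn (b i) (Set.Ioo lo hi))
    (u : Set ℝ) (hu : u ∈ 𝓝 t)
    (hadiff : ∀ i, ∀ x ∈ u,
      HasDerivAt (a i) (a' i x) x ∧ HasDerivAt (a' i) (a'' i x) x ∧
        HasDerivAt (a'' i) (a''' i x) x)
    (hbdiff : ∀ i, ∀ x ∈ u,
      HasDerivAt (b i) (b' i x) x ∧ HasDerivAt (b' i) (b'' i x) x ∧
        HasDerivAt (b'' i) (b''' i x) x)
    (ha0 : a 0 t * a 1 t = a 2 t * a 3 t)
    (hb0 : b 0 t * b 1 t = b 2 t * b 3 t)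
    (hbne : b'' 0 t * b 1 t + b 0 t * b'' 1 t - b'' 2 t * b 3 t - b 2 t * b'' 3 t ≠ 0) :
    Tendsto (fun δ : ℝ =>
        ((∫ x in (t - δ)..(t + δ), a 0 x) * (∫ x in (t - δ)..(t + δ), a 1 x) -
          (∫ x in (t - δ)..(t + δ), a 2 x) * (∫ x in (t - δ)..(t + δ), a 3 x)) /
        ((∫ x in (t - δ)..(t + δ), b 0 x) * (∫ x in (t - δ)..(t + δ), b 1 x) -
          (∫ x in (t - δ)..(t + δ), b 2 x) * (∫ x in (t - δ)..(t + δ), b 3 x)))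
      (𝓝[>] (0 : ℝ))
      (𝓝 ((a'' 0 t * a 1 t + a 0 t * a'' 1 t - a'' 2 t * a 3 t - a 2 t * a'' 3 t) /
          (b'' 0 t * b 1 t + b 0 t * b'' 1 t - b'' 2 t * b 3 t - b 2 t * b'' 3 t))) := by
  have hA := key_product t a a' a'' a''' u hu hadiff ha0
  have hB := key_product t b b' b'' b''' u hu hbdiff hb0
  have h := hA.div hB (mul_ne_zero (by norm_num) hbne)
  rw [mul_div_mul_left _ _ (by norm_num : (2 / 3 : ℝ) ≠ 0)] at h
  refine h.congr' ?_
  filter_upwards [eventually_mem_nhdsWithin] with δ hδ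
  have hδ' : δ ^ 4 ≠ 0 := pow_ne_zero 4 (ne_of_gt hδ)
  exact div_div_div_cancel_right₀ hδ' _ _
end

section
/- In the finite missing-data model with smooth parametrization, fix θ0 ∈ Θ, and for δ > 0 small enough that (θ0 − δ, θ0 + δ) ⊆ Θ, let π_δ be the uniform distribution on (θ0 − δ, θ0 + δ). Define BI₁^{π_δ} as the variance of θ ↦ LR(θ0,θ|y) under the posterior p(dθ|y) built from π_δ, divided by the variance of (θ,ω) ↦ LR(θ0,θ|ω) under the joint posterior p(dθ|y) f(ω|y,θ) on Θ × Ω_y. Let S = ℓ_ob'(θ0) and I_mi = Σ_{ω∈Ω_y} f(ω|y,θ0) (∂/∂θ log f(ω|y,θ)|_{θ=θ0})², and assume S² + I_mi > 0. Then for all sufficiently small δ > 0 the denominator of BI₁^{π_δ} is positive, and lim_{δ→0⁺} BI₁^{π_δ} = S² / (S² + I_mi). -/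
open Topology Filter MeasureTheory

lemma aux_int (Θ : Set ℝ) (hΘ : IsOpen Θ) (θ0 : ℝ) (h0 : θ0 ∈ Θ) (u : ℝ → ℝ)
    (hu : ContinuousOn u Θ) (n : ℕ) :
    Tendsto (fun δ => (∫ θ in Set.Ioo (θ0 - δ) (θ0 + δ), (θ - θ0) ^ n * u θ) / δ ^ (n + 1))
      (𝓝[>] (0 : ℝ)) (𝓝 (∫ t in (-1 : ℝ)..1, t ^ n * u θ0)) := by
  have hc : ContinuousAt u θ0 := hu.continuousAt (hΘ.mem_nhds h0)
  have hev : ∀ᶠ θ in 𝓝 θ0, θ ∈ Θ ∧ |u θ| ≤ |u θ0| + 1 := by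
    refine Filter.Eventually.and (hΘ.mem_nhds h0) ?_
    have := hc.abs.eventually (gt_mem_nhds (show |u θ0| < |u θ0| + 1 by linarith))
    exact this.mono fun _ h => le_of_lt h
  obtain ⟨r, hr, hball⟩ := Metric.eventually_nhds_iff.1 hev
  have hin : ∀ δ ∈ Set.Ioo (0 : ℝ) r, ∀ t ∈ Set.Icc (-1 : ℝ) 1,
      θ0 + δ * t ∈ Θ ∧ |u (θ0 + δ * t)| ≤ |u θ0| + 1 := by
    intro δ hδ t ht
    apply hball
    rw [Real.dist_eq, add_sub_cancel_left, abs_mul, abs_of_pos hδ.1]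
    have : |t| ≤ 1 := abs_le.2 ht
    nlinarith [hδ.1, hδ.2]
  have hsm : ∀ᶠ δ in 𝓝[>] (0 : ℝ), δ ∈ Set.Ioo (0 : ℝ) r := Ioo_mem_nhdsGT hr
  have key : Tendsto (fun δ => ∫ t in (-1 : ℝ)..1, t ^ n * u (θ0 + δ * t))
      (𝓝[>] (0 : ℝ)) (𝓝 (∫ t in (-1 : ℝ)..1, t ^ n * u θ0)) := by
    apply intervalIntegral.tendsto_integral_filter_of_dominated_convergence (fun _ => |u θ0| + 1)
    · filter_upwards [hsm] with δ hδ
      rw [Set.uIoc_of_le (by norm_num)]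
      apply ContinuousOn.aestronglyMeasurable _ measurableSet_Ioc
      apply ContinuousOn.mul (by fun_prop)
      apply hu.comp (by fun_prop)
      intro t ht
      exact (hin δ hδ t ⟨ht.1.le, ht.2⟩).1
    · filter_upwards [hsm] with δ hδ
      refine Eventually.of_forall fun t ht => ?_
      rw [Set.uIoc_of_le (by norm_num)] at ht
      have h2 := (hin δ hδ t ⟨ht.1.le, ht.2⟩).2
      rw [Real.norm_eq_abs, abs_mul, abs_pow]
      have h1 : |t| ^ n ≤ 1 := pow_le_one₀ (abs_nonneg _) (abs_le.2 ⟨ht.1.le, ht.2⟩)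
      nlinarith [abs_nonneg (u (θ0 + δ * t)), abs_nonneg t]
    · simp
    · refine Eventually.of_forall fun t _ => ?_
      apply Tendsto.const_mul
      have : Tendsto (fun δ : ℝ => θ0 + δ * t) (𝓝[>] 0) (𝓝 θ0) := by
        have : Tendsto (fun δ : ℝ => θ0 + δ * t) (𝓝 0) (𝓝 (θ0 + 0 * t)) :=
          Continuous.tendsto (by fun_prop) 0
        simp only [zero_mul, add_zero] at this
        exact this.mono_left nhdsWithin_le_nhds
      exact hc.tendsto.comp this
  refine key.congr' ?_
  filter_upwards [hsm] with δ hδ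
  have hδ0 := hδ.1
  rw [← integral_Ioc_eq_integral_Ioo, ← intervalIntegral.integral_of_le (by linarith)]
  have := intervalIntegral.integral_comp_add_mul (a := -1) (b := 1)
    (fun θ => (θ - θ0) ^ n * u θ) hδ0.ne' θ0
  simp only [add_sub_cancel_left, mul_neg, mul_one, ← sub_eq_add_neg, smul_eq_mul] at this
  rw [eq_div_iff (by positivity), pow_succ, ← mul_assoc, ← intervalIntegral.integral_mul_const]
  have h3 : (∫ t in (-1 : ℝ)..1, t ^ n * u (θ0 + δ * t) * δ ^ n)
      = ∫ t in (-1 : ℝ)..1, (δ * t) ^ n * u (θ0 + δ * t) := by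
    congr 1; ext t; rw [mul_pow]; ring
  rw [h3, this]
  field_simp

lemma aux_var (Θ : Set ℝ) (hΘ : IsOpen Θ) (θ0 : ℝ) (h0 : θ0 ∈ Θ) (w p q G1 G2 : ℝ → ℝ)
    (hw : ContinuousOn w Θ) (hp : ContinuousOn p Θ) (hq : ContinuousOn q Θ)
    (hw0 : 0 < w θ0)
    (hG1 : ∀ θ ∈ Θ, G1 θ = w θ + (θ - θ0) * p θ)
    (hG2 : ∀ θ ∈ Θ, G2 θ = w θ + 2 * ((θ - θ0) * p θ) + (θ - θ0) ^ 2 * q θ) :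
    Tendsto (fun δ => ((∫ θ in Set.Ioo (θ0 - δ) (θ0 + δ), G2 θ) /
        (∫ θ in Set.Ioo (θ0 - δ) (θ0 + δ), w θ) -
        ((∫ θ in Set.Ioo (θ0 - δ) (θ0 + δ), G1 θ) /
        (∫ θ in Set.Ioo (θ0 - δ) (θ0 + δ), w θ)) ^ 2) / δ ^ 2)
      (𝓝[>] (0 : ℝ)) (𝓝 (q θ0 / (3 * w θ0))) := by
  have hZ := aux_int Θ hΘ θ0 h0 w hw 0
  have hB := aux_int Θ hΘ θ0 h0 p hp 1
  have hA := aux_int Θ hΘ θ0 h0 q hq 2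
  have e0 : (∫ t in (-1 : ℝ)..1, t ^ 0 * w θ0) = 2 * w θ0 := by
    rw [intervalIntegral.integral_mul_const, integral_pow]; norm_num
  have e1 : (∫ t in (-1 : ℝ)..1, t ^ 1 * p θ0) = 0 := by
    rw [intervalIntegral.integral_mul_const, integral_pow]; norm_num
  have e2 : (∫ t in (-1 : ℝ)..1, t ^ 2 * q θ0) = 2 / 3 * q θ0 := by
    rw [intervalIntegral.integral_mul_const, integral_pow]; norm_num
  rw [e0] at hZ; rw [e1] at hB; rw [e2] at hA
  have hlim := (hA.div hZ (by positivity)).sub ((hB.div hZ (by positivity)).pow 2)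
  have e3 : 2 / 3 * q θ0 / (2 * w θ0) - (0 / (2 * w θ0)) ^ 2 = q θ0 / (3 * w θ0) := by
    field_simp; ring
  rw [e3] at hlim
  refine hlim.congr' ?_
  obtain ⟨r, hr, hball⟩ := Metric.isOpen_iff.1 hΘ θ0 h0
  have hsm : ∀ᶠ δ in 𝓝[>] (0 : ℝ), δ ∈ Set.Ioo (0 : ℝ) r := Ioo_mem_nhdsGT hr
  have hZpos := hZ.eventually (lt_mem_nhds (show 0 < 2 * w θ0 by positivity))
  filter_upwards [hsm, hZpos] with δ hδ hZp
  have hδ0 := hδ.1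
  have hsub : Set.Icc (θ0 - δ) (θ0 + δ) ⊆ Θ := by
    intro t ht
    apply hball
    rw [Metric.mem_ball, Real.dist_eq]
    have : |t - θ0| ≤ δ := abs_le.2 ⟨by linarith [ht.1], by linarith [ht.2]⟩
    linarith [hδ.2]
  have hsub' : Set.Ioo (θ0 - δ) (θ0 + δ) ⊆ Θ := Set.Ioo_subset_Icc_self.trans hsub
  have integ : ∀ v : ℝ → ℝ, ContinuousOn v Θ →
      IntegrableOn v (Set.Ioo (θ0 - δ) (θ0 + δ)) := fun v hv =>
    ((hv.mono hsub).integrableOn_Icc).mono_set Set.Ioo_subset_Icc_self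
  have iw := integ w hw
  have ip := integ (fun θ => (θ - θ0) * p θ) (ContinuousOn.mul (by fun_prop) hp)
  have iq := integ (fun θ => (θ - θ0) ^ 2 * q θ) (ContinuousOn.mul (by fun_prop) hq)
  have I1 : (∫ θ in Set.Ioo (θ0 - δ) (θ0 + δ), G1 θ) =
      (∫ θ in Set.Ioo (θ0 - δ) (θ0 + δ), w θ) +
      ∫ θ in Set.Ioo (θ0 - δ) (θ0 + δ), (θ - θ0) * p θ := by
    rw [← integral_add iw ip]
    exact setIntegral_congr_fun measurableSet_Ioo fun t ht => hG1 t (hsub' ht)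
  have I2 : (∫ θ in Set.Ioo (θ0 - δ) (θ0 + δ), G2 θ) =
      (∫ θ in Set.Ioo (θ0 - δ) (θ0 + δ), w θ) +
      2 * (∫ θ in Set.Ioo (θ0 - δ) (θ0 + δ), (θ - θ0) * p θ) +
      ∫ θ in Set.Ioo (θ0 - δ) (θ0 + δ), (θ - θ0) ^ 2 * q θ := by
    rw [← integral_const_mul, ← integral_add iw (ip.const_mul 2),
      ← integral_add (f := fun a => w a + 2 * ((a - θ0) * p a)) (iw.add (ip.const_mul 2)) iq]
    exact setIntegral_congr_fun measurableSet_Ioo fun t ht => hG2 t (hsub' ht)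
  rw [I1, I2]
  simp only [Pi.div_apply, pow_zero, one_mul, zero_add, pow_one, Nat.reduceAdd] at hZp ⊢
  generalize (∫ θ in Set.Ioo (θ0 - δ) (θ0 + δ), w θ) = Z at *
  generalize (∫ θ in Set.Ioo (θ0 - δ) (θ0 + δ), (θ - θ0) * p θ) = B at *
  generalize (∫ θ in Set.Ioo (θ0 - δ) (θ0 + δ), (θ - θ0) ^ 2 * q θ) = A at *
  have hZ0 : 0 < Z := by
    have := mul_pos hZp hδ0
    rwa [div_mul_cancel₀ _ hδ0.ne'] at this
  field_simp
  ring

/-- Proposition 1, case k = 1: in the finite missing-data model with smooth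
parametrization, let `π_δ` be uniform on `(θ0−δ, θ0+δ)` and `BI₁^{π_δ}` the posterior
variance of `θ ↦ LR(θ0,θ|y)` divided by the joint-posterior variance of
`(θ,ω) ↦ LR(θ0,θ|ω)`.  With `S = ℓ_ob'(θ0)`,
`I_mi = ∑_{ω∈Ωy} f(ω|y,θ0)(∂ log f(ω|y,θ)/∂θ|_{θ0})²` and `S² + I_mi > 0`, the
denominator of `BI₁^{π_δ}` is eventually positive as `δ → 0⁺` and
`BI₁^{π_δ} → S²/(S² + I_mi)`. -/
theorem stmt_2 {Ω O : Type*} [Fintype Ω]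
    (g : Ω → O) (y : O) (Ωy : Finset Ω) (hΩy : ∀ ω, ω ∈ Ωy ↔ g ω = y)
    (hne : Ωy.Nonempty)
    (Θ : Set ℝ) (hΘopen : IsOpen Θ) (hΘconn : Θ.OrdConnected)
    (f : ℝ → Ω → ℝ)
    (hpos : ∀ θ ∈ Θ, ∀ ω, 0 < f θ ω)
    (hsum : ∀ θ ∈ Θ, ∑ ω, f θ ω = 1)
    (hsmooth : ∀ ω, ContDiffOn ℝ (⊤ : ℕ∞) (fun θ => f θ ω) Θ)
    (θ0 : ℝ) (hθ0 : θ0 ∈ Θ)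
    (fob : ℝ → ℝ) (hfob : ∀ θ, fob θ = ∑ ω ∈ Ωy, f θ ω)
    (fcond : ℝ → Ω → ℝ) (hfcond : ∀ θ ω, fcond θ ω = f θ ω / fob θ)
    (S : ℝ) (hS : S = deriv (fun θ => Real.log (fob θ)) θ0)
    (Imi : ℝ)
    (hImi : Imi = ∑ ω ∈ Ωy, fcond θ0 ω * (deriv (fun θ => Real.log (fcond θ ω)) θ0) ^ 2)
    (hpos2 : 0 < S ^ 2 + Imi)
    -- posterior expectation under the uniform prior on (θ0−δ, θ0+δ)
    (Epost : ℝ → (ℝ → ℝ) → ℝ)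
    (hEpost : ∀ δ h, Epost δ h =
      (∫ θ in Set.Ioo (θ0 - δ) (θ0 + δ), fob θ * h θ) /
        (∫ θ in Set.Ioo (θ0 - δ) (θ0 + δ), fob θ))
    -- joint-posterior expectation under the uniform prior on (θ0−δ, θ0+δ)
    (Ejoint : ℝ → (ℝ → Ω → ℝ) → ℝ)
    (hEjoint : ∀ δ h, Ejoint δ h =
      (∫ θ in Set.Ioo (θ0 - δ) (θ0 + δ), ∑ ω ∈ Ωy, f θ ω * h θ ω) /
        (∫ θ in Set.Ioo (θ0 - δ) (θ0 + δ), fob θ))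
    -- numerator and denominator of BI₁^{π_δ}
    (num den : ℝ → ℝ)
    (hnum : ∀ δ, num δ = Epost δ (fun θ => (fob θ0 / fob θ) ^ 2) -
      (Epost δ (fun θ => fob θ0 / fob θ)) ^ 2)
    (hden : ∀ δ, den δ = Ejoint δ (fun θ ω => (f θ0 ω / f θ ω) ^ 2) -
      (Ejoint δ (fun θ ω => f θ0 ω / f θ ω)) ^ 2) :
    (∀ᶠ δ in 𝓝[>] (0 : ℝ), 0 < den δ) ∧
    Tendsto (fun δ => num δ / den δ) (𝓝[>] (0 : ℝ)) (𝓝 (S ^ 2 / (S ^ 2 + Imi))) := by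
  have hnh := hΘopen.mem_nhds hθ0
  have hdiff : ∀ ω, DifferentiableAt ℝ (fun θ => f θ ω) θ0 := fun ω =>
    ((hsmooth ω).contDiffAt hnh).differentiableAt (by simp)
  have hcont : ∀ ω, ContinuousOn (fun θ => f θ ω) Θ := fun ω => (hsmooth ω).continuousOn
  have hfobpos : ∀ θ ∈ Θ, 0 < fob θ := fun θ hθ => by
    rw [hfob]; exact Finset.sum_pos (fun ω _ => hpos θ hθ ω) hne
  have hfobeq : fob = fun θ => ∑ ω ∈ Ωy, f θ ω := funext hfob
  have hfobc : ContinuousOn fob Θ := by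
    rw [hfobeq]; exact continuousOn_finsetSum _ fun ω _ => hcont ω
  have hfobd : HasDerivAt fob (∑ ω ∈ Ωy, deriv (fun θ => f θ ω) θ0) θ0 := by
    rw [hfobeq]; exact HasDerivAt.fun_sum fun ω _ => (hdiff ω).hasDerivAt
  have hds : ∀ ω, ContinuousOn (dslope (fun θ => f θ ω) θ0) Θ := fun ω =>
    (continuousOn_dslope hnh).2 ⟨hcont ω, hdiff ω⟩
  have hdso : ContinuousOn (dslope fob θ0) Θ :=
    (continuousOn_dslope hnh).2 ⟨hfobc, hfobd.differentiableAt⟩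
  have hE : ∀ ω θ, (θ - θ0) * dslope (fun θ => f θ ω) θ0 θ = f θ ω - f θ0 ω := fun ω θ => by
    simpa using sub_smul_dslope (fun θ => f θ ω) θ0 θ
  have hEo : ∀ θ, (θ - θ0) * dslope fob θ0 θ = fob θ - fob θ0 := fun θ => by
    simpa using sub_smul_dslope fob θ0 θ
  have hw0 := hfobpos θ0 hθ0
  have hN := aux_var Θ hΘopen θ0 hθ0 fob (fun θ => - dslope fob θ0 θ)
    (fun θ => (dslope fob θ0 θ) ^ 2 / fob θ)
    (fun θ => fob θ * (fob θ0 / fob θ)) (fun θ => fob θ * (fob θ0 / fob θ) ^ 2)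
    hfobc hdso.neg ((hdso.pow 2).div hfobc fun θ hθ => (hfobpos θ hθ).ne') hw0
    (fun θ hθ => by
      have := (hfobpos θ hθ).ne'
      simp only [mul_neg, hEo]
      field_simp; ring)
    (fun θ hθ => by
      have := (hfobpos θ hθ).ne'
      simp only [mul_neg, ← mul_div_assoc, ← mul_pow, hEo]
      field_simp; ring)
  have hD := aux_var Θ hΘopen θ0 hθ0 fob (fun θ => - dslope fob θ0 θ)
    (fun θ => ∑ ω ∈ Ωy, (dslope (fun θ => f θ ω) θ0 θ) ^ 2 / f θ ω)
    (fun θ => ∑ ω ∈ Ωy, f θ ω * (f θ0 ω / f θ ω))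
    (fun θ => ∑ ω ∈ Ωy, f θ ω * (f θ0 ω / f θ ω) ^ 2)
    hfobc hdso.neg
    (continuousOn_finsetSum _ fun ω _ =>
      ((hds ω).pow 2).div (hcont ω) fun θ hθ => (hpos θ hθ ω).ne') hw0
    (fun θ hθ => by
      simp only [mul_neg, hEo]
      rw [show fob θ + -(fob θ - fob θ0) = fob θ0 by ring, hfob]
      refine Finset.sum_congr rfl fun ω _ => ?_
      have := (hpos θ hθ ω).ne'
      field_simp)
    (fun θ hθ => by
      simp only [mul_neg, hEo, Finset.mul_sum, ← mul_div_assoc, ← mul_pow, hE]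
      rw [show fob θ + -(2 * (fob θ - fob θ0)) = 2 * fob θ0 - fob θ by ring, hfob, hfob,
        Finset.mul_sum, ← Finset.sum_sub_distrib, ← Finset.sum_add_distrib]
      refine Finset.sum_congr rfl fun ω _ => ?_
      have := (hpos θ hθ ω).ne'
      field_simp; ring)
  have hNe : ∀ δ, num δ = _ := fun δ => by rw [hnum, hEpost, hEpost]
  have hDe : ∀ δ, den δ = _ := fun δ => by rw [hden, hEjoint, hEjoint]
  simp only [← hNe, dslope_same] at hN
  simp only [← hDe, dslope_same] at hD
  have hS' : S = deriv fob θ0 / fob θ0 := by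
    rw [hS]; exact (hfobd.differentiableAt.hasDerivAt.log hw0.ne').deriv
  have hlc : ∀ ω, deriv (fun θ => Real.log (fcond θ ω)) θ0
      = deriv (fun θ => f θ ω) θ0 / f θ0 ω - S := fun ω => by
    have h1 := ((hdiff ω).hasDerivAt.log (hpos θ0 hθ0 ω).ne').sub
      (hfobd.differentiableAt.hasDerivAt.log hw0.ne')
    rw [hS', ← h1.deriv]
    apply Filter.EventuallyEq.deriv_eq
    filter_upwards [hnh] with θ hθ
    rw [hfcond, Real.log_div (hpos θ hθ ω).ne' (hfobpos θ hθ).ne']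
    rfl
  have hI : S ^ 2 + Imi =
      (∑ ω ∈ Ωy, (deriv (fun θ => f θ ω) θ0) ^ 2 / f θ0 ω) / fob θ0 := by
    have hterm : ∀ ω ∈ Ωy, fcond θ0 ω * (deriv (fun θ => Real.log (fcond θ ω)) θ0) ^ 2
        = (deriv (fun θ => f θ ω) θ0) ^ 2 / f θ0 ω / fob θ0
          - 2 * S / fob θ0 * deriv (fun θ => f θ ω) θ0 + S ^ 2 / fob θ0 * f θ0 ω := by
      intro ω _
      rw [hlc, hfcond]
      have := (hpos θ0 hθ0 ω).ne'
      field_simp; ring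
    rw [hImi, Finset.sum_congr rfl hterm, Finset.sum_add_distrib, Finset.sum_sub_distrib,
      ← Finset.mul_sum, ← Finset.mul_sum, ← Finset.sum_div, ← hfob, ← hfobd.deriv, hS']
    field_simp; ring
  have hN' : Tendsto (fun δ => num δ / δ ^ 2) (𝓝[>] (0 : ℝ)) (𝓝 (S ^ 2 / 3)) := by
    convert hN using 2
    rw [hS']; field_simp
  have hD' : Tendsto (fun δ => den δ / δ ^ 2) (𝓝[>] (0 : ℝ)) (𝓝 ((S ^ 2 + Imi) / 3)) := by
    convert hD using 2
    rw [hI]; field_simp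
  have hp : ∀ᶠ δ in 𝓝[>] (0 : ℝ), (0 : ℝ) < δ := self_mem_nhdsWithin
  constructor
  · filter_upwards [hp, hD'.eventually (lt_mem_nhds (show 0 < (S ^ 2 + Imi) / 3 by positivity))]
      with δ hδ h
    have := mul_pos h (pow_pos hδ 2)
    rwa [div_mul_cancel₀ _ (pow_pos hδ 2).ne'] at this
  · have := hN'.div hD' (by positivity)
    rw [div_div_div_cancel_right₀ (by norm_num)] at this
    refine this.congr' ?_
    filter_upwards [hp] with δ hδ
    exact div_div_div_cancel_right₀ (pow_pos hδ 2).ne' _ _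
end

section
/- In the finite missing-data model, for every θ1, θ2 ∈ Θ, Σ_{ω∈Ω_y} f(ω|y,θ1) lod(θ1,θ2|ω) = lod(θ1,θ2|y) + KL(θ1:θ2) ≥ lod(θ1,θ2|y), where KL(θ1:θ2) ≥ 0; moreover equality holds (equivalently KL(θ1:θ2) = 0) if and only if f(ω|y,θ1) = f(ω|y,θ2) for all ω ∈ Ω_y. -/
/-- in the finite missing-data model, for all `θ1, θ2`,
`∑_{ω∈Ωy} f(ω|y,θ1) lod(θ1,θ2|ω) = lod(θ1,θ2|y) + KL(θ1:θ2) ≥ lod(θ1,θ2|y)` with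
`KL(θ1:θ2) ≥ 0`, and `KL(θ1:θ2) = 0` (equivalently, equality holds) iff
`f(ω|y,θ1) = f(ω|y,θ2)` for all `ω ∈ Ωy`. -/
theorem stmt_5 {Ω O Θ : Type*} [Fintype Ω]
    (g : Ω → O) (y : O) (Ωy : Finset Ω) (hΩy : ∀ ω, ω ∈ Ωy ↔ g ω = y)
    (hne : Ωy.Nonempty)
    (f : Θ → Ω → ℝ) (hpos : ∀ θ ω, 0 < f θ ω)
    (fob : Θ → ℝ) (hfob : ∀ θ, fob θ = ∑ ω ∈ Ωy, f θ ω)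
    (fcond : Θ → Ω → ℝ) (hfcond : ∀ θ ω, fcond θ ω = f θ ω / fob θ)
    (KL : Θ → Θ → ℝ)
    (hKL : ∀ θ1 θ2, KL θ1 θ2 = ∑ ω ∈ Ωy, fcond θ1 ω * Real.log (fcond θ1 ω / fcond θ2 ω))
    (θ1 θ2 : Θ) :
    (∑ ω ∈ Ωy, fcond θ1 ω * (Real.log (f θ1 ω) - Real.log (f θ2 ω)) =
      (Real.log (fob θ1) - Real.log (fob θ2)) + KL θ1 θ2) ∧
    0 ≤ KL θ1 θ2 ∧
    (Real.log (fob θ1) - Real.log (fob θ2) ≤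
      ∑ ω ∈ Ωy, fcond θ1 ω * (Real.log (f θ1 ω) - Real.log (f θ2 ω))) ∧
    (KL θ1 θ2 = 0 ↔ ∀ ω ∈ Ωy, fcond θ1 ω = fcond θ2 ω) := by
  have hob : ∀ θ, 0 < fob θ := fun θ => by
    rw [hfob]; exact Finset.sum_pos (fun ω _ => hpos θ ω) hne
  have hc : ∀ θ ω, 0 < fcond θ ω := fun θ ω => by
    rw [hfcond]; exact div_pos (hpos θ ω) (hob θ)
  have hsum : ∀ θ, ∑ ω ∈ Ωy, fcond θ ω = 1 := fun θ => by
    simp only [hfcond]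
    rw [← Finset.sum_div, ← hfob, div_self (hob θ).ne']
  have hid : ∑ ω ∈ Ωy, fcond θ1 ω * (Real.log (f θ1 ω) - Real.log (f θ2 ω)) =
      (Real.log (fob θ1) - Real.log (fob θ2)) + KL θ1 θ2 := by
    have h1 : Real.log (fob θ1) - Real.log (fob θ2) =
        ∑ ω ∈ Ωy, fcond θ1 ω * (Real.log (fob θ1) - Real.log (fob θ2)) := by
      rw [← Finset.sum_mul, hsum, one_mul]
    rw [h1, hKL, ← Finset.sum_add_distrib]
    refine Finset.sum_congr rfl fun ω _ => ?_
    rw [Real.log_div (hc θ1 ω).ne' (hc θ2 ω).ne', hfcond θ2 ω,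
      Real.log_div (hpos θ2 ω).ne' (hob θ2).ne']
    have h2 : Real.log (fcond θ1 ω) = Real.log (f θ1 ω) - Real.log (fob θ1) := by
      rw [hfcond, Real.log_div (hpos θ1 ω).ne' (hob θ1).ne']
    rw [h2]; ring
  have hKL' : KL θ1 θ2 = ∑ ω ∈ Ωy, fcond θ1 ω *
      ((fcond θ2 ω / fcond θ1 ω - 1) - Real.log (fcond θ2 ω / fcond θ1 ω)) := by
    have h0 : KL θ1 θ2 = KL θ1 θ2 + (∑ ω ∈ Ωy, fcond θ2 ω - ∑ ω ∈ Ωy, fcond θ1 ω) := by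
      rw [hsum, hsum]; ring
    rw [h0, hKL, ← Finset.sum_sub_distrib, ← Finset.sum_add_distrib]
    refine Finset.sum_congr rfl fun ω _ => ?_
    have h3 := (hc θ1 ω).ne'
    rw [Real.log_div h3 (hc θ2 ω).ne', Real.log_div (hc θ2 ω).ne' h3]
    field_simp
    ring
  have hterm : ∀ ω ∈ Ωy, 0 ≤ fcond θ1 ω *
      ((fcond θ2 ω / fcond θ1 ω - 1) - Real.log (fcond θ2 ω / fcond θ1 ω)) := fun ω _ =>
    mul_nonneg (hc θ1 ω).le
      (sub_nonneg.2 (Real.log_le_sub_one_of_pos (div_pos (hc θ2 ω) (hc θ1 ω))))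
  have hnn : 0 ≤ KL θ1 θ2 := by rw [hKL']; exact Finset.sum_nonneg hterm
  refine ⟨hid, hnn, by rw [hid]; linarith, ?_⟩
  constructor
  · intro h ω hω
    rw [hKL', Finset.sum_eq_zero_iff_of_nonneg hterm] at h
    by_contra hcon
    have hne1 : fcond θ2 ω / fcond θ1 ω ≠ 1 := fun h1 =>
      hcon ((div_eq_one_iff_eq (hc θ1 ω).ne').1 h1).symm
    have hlt := Real.log_lt_sub_one_of_pos (div_pos (hc θ2 ω) (hc θ1 ω)) hne1
    exact (mul_pos (hc θ1 ω) (sub_pos.2 hlt)).ne' (h ω hω)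
  · intro h
    rw [hKL]
    refine Finset.sum_eq_zero fun ω hω => ?_
    rw [h ω hω, div_self (hc θ2 ω).ne', Real.log_one, mul_zero]
end

section
/- In the finite missing-data model, for every θ1, θ2 ∈ Θ, Σ_{ω∈Ω_y} f(ω|y,θ2) lod(θ1,θ2|ω) = lod(θ1,θ2|y) − KL(θ2:θ1) ≤ lod(θ1,θ2|y); moreover equality holds if and only if f(ω|y,θ1) = f(ω|y,θ2) for all ω ∈ Ω_y. -/
/-- in the finite missing-data model, for all `θ1, θ2`,
`∑_{ω∈Ωy} f(ω|y,θ2) lod(θ1,θ2|ω) = lod(θ1,θ2|y) − KL(θ2:θ1) ≤ lod(θ1,θ2|y)`,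
with equality iff `f(ω|y,θ1) = f(ω|y,θ2)` for all `ω ∈ Ωy`. -/
theorem stmt_6 {Ω O Θ : Type*} [Fintype Ω]
    (g : Ω → O) (y : O) (Ωy : Finset Ω) (hΩy : ∀ ω, ω ∈ Ωy ↔ g ω = y)
    (hne : Ωy.Nonempty)
    (f : Θ → Ω → ℝ) (hpos : ∀ θ ω, 0 < f θ ω)
    (fob : Θ → ℝ) (hfob : ∀ θ, fob θ = ∑ ω ∈ Ωy, f θ ω)
    (fcond : Θ → Ω → ℝ) (hfcond : ∀ θ ω, fcond θ ω = f θ ω / fob θ)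
    (KL : Θ → Θ → ℝ)
    (hKL : ∀ θ θ', KL θ θ' = ∑ ω ∈ Ωy, fcond θ ω * Real.log (fcond θ ω / fcond θ' ω))
    (θ1 θ2 : Θ) :
    (∑ ω ∈ Ωy, fcond θ2 ω * (Real.log (f θ1 ω) - Real.log (f θ2 ω)) =
      (Real.log (fob θ1) - Real.log (fob θ2)) - KL θ2 θ1) ∧
    (∑ ω ∈ Ωy, fcond θ2 ω * (Real.log (f θ1 ω) - Real.log (f θ2 ω)) ≤
      Real.log (fob θ1) - Real.log (fob θ2)) ∧
    (∑ ω ∈ Ωy, fcond θ2 ω * (Real.log (f θ1 ω) - Real.log (f θ2 ω)) =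
        Real.log (fob θ1) - Real.log (fob θ2) ↔
      ∀ ω ∈ Ωy, fcond θ1 ω = fcond θ2 ω) := by
  have hob : ∀ θ, 0 < fob θ := fun θ => by
    rw [hfob]
    exact Finset.sum_pos (fun ω _ => hpos θ ω) hne
  have hcp : ∀ θ ω, 0 < fcond θ ω := fun θ ω => by
    rw [hfcond]
    exact div_pos (hpos θ ω) (hob θ)
  have hsum : ∀ θ, ∑ ω ∈ Ωy, fcond θ ω = 1 := fun θ => by
    simp only [hfcond]
    rw [← Finset.sum_div, ← hfob]
    exact div_self (hob θ).ne'
  have hlog : ∀ θ ω, Real.log (fcond θ ω) = Real.log (f θ ω) - Real.log (fob θ) := fun θ ω => by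
    rw [hfcond, Real.log_div (hpos θ ω).ne' (hob θ).ne']
  have h1 : ∑ ω ∈ Ωy, fcond θ2 ω * (Real.log (f θ1 ω) - Real.log (f θ2 ω)) =
      (Real.log (fob θ1) - Real.log (fob θ2)) - KL θ2 θ1 := by
    have e : (Real.log (fob θ1) - Real.log (fob θ2)) =
        ∑ ω ∈ Ωy, fcond θ2 ω * (Real.log (fob θ1) - Real.log (fob θ2)) := by
      rw [← Finset.sum_mul, hsum, one_mul]
    rw [e, hKL, ← Finset.sum_sub_distrib]
    refine Finset.sum_congr rfl fun ω _ => ?_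
    rw [Real.log_div (hcp θ2 ω).ne' (hcp θ1 ω).ne', hlog, hlog]
    ring
  have key : ∀ ω, fcond θ2 ω * Real.log (fcond θ2 ω / fcond θ1 ω) =
      - (fcond θ2 ω * Real.log (fcond θ1 ω / fcond θ2 ω)) := fun ω => by
    rw [← inv_div, Real.log_inv]
    ring
  have hmul : ∀ ω, fcond θ2 ω * (fcond θ1 ω / fcond θ2 ω - 1) = fcond θ1 ω - fcond θ2 ω :=
    fun ω => by
      have := (hcp θ2 ω).ne'
      field_simp
  have hle : ∀ ω ∈ Ωy, 0 ≤ fcond θ2 ω * Real.log (fcond θ2 ω / fcond θ1 ω)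
      - (fcond θ2 ω - fcond θ1 ω) := fun ω _ => by
    have := mul_le_mul_of_nonneg_left
      (Real.log_le_sub_one_of_pos (div_pos (hcp θ1 ω) (hcp θ2 ω))) (hcp θ2 ω).le
    rw [hmul] at this
    rw [key]
    linarith
  have hKL' : KL θ2 θ1 = ∑ ω ∈ Ωy, (fcond θ2 ω * Real.log (fcond θ2 ω / fcond θ1 ω)
      - (fcond θ2 ω - fcond θ1 ω)) := by
    rw [Finset.sum_sub_distrib, Finset.sum_sub_distrib, hsum, hsum, hKL]
    ring
  have hnn : 0 ≤ KL θ2 θ1 := by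
    rw [hKL']
    exact Finset.sum_nonneg hle
  refine ⟨h1, by rw [h1]; linarith, ?_⟩
  rw [h1]
  constructor
  · intro h ω hω
    have h0 : KL θ2 θ1 = 0 := by linarith
    rw [hKL', Finset.sum_eq_zero_iff_of_nonneg hle] at h0
    have hz := h0 ω hω
    by_contra hneq
    have := mul_lt_mul_of_pos_left
      (Real.log_lt_sub_one_of_pos (div_pos (hcp θ1 ω) (hcp θ2 ω))
        (fun h => hneq ((div_eq_one_iff_eq (hcp θ2 ω).ne').1 h))) (hcp θ2 ω)
    rw [hmul] at this
    rw [key] at hz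
    linarith
  · intro h
    have h0 : KL θ2 θ1 = 0 := by
      rw [hKL]
      refine Finset.sum_eq_zero fun ω hω => ?_
      rw [h ω hω, div_self (hcp θ2 ω).ne', Real.log_one, mul_zero]
    rw [h0, sub_zero]
end

section
/- In the finite missing-data model, let θ_ob ∈ Θ satisfy ℓ_ob(θ_ob) ≥ ℓ_ob(θ) for all θ ∈ Θ (θ_ob is an MLE), and let θ0 ∈ Θ satisfy ℓ_ob(θ_ob) > ℓ_ob(θ0). Define the relative information against the null as RI₁ = (ℓ_ob(θ_ob) − ℓ_ob(θ0)) / (Q(θ_ob|θ_ob) − Q(θ0|θ_ob)). Then the denominator equals (ℓ_ob(θ_ob) − ℓ_ob(θ0)) + KL(θ_ob:θ0) and is strictly positive, 0 < RI₁ ≤ 1, and RI₁ = 1 if and only if f(ω|y,θ_ob) = f(ω|y,θ0) for all ω ∈ Ω_y. -/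
/-- in the finite missing-data model, if `θ_ob` is an MLE of the
observed-data log-likelihood and `ℓ_ob(θ_ob) > ℓ_ob(θ0)`, then for
`RI₁ = (ℓ_ob(θ_ob) − ℓ_ob(θ0)) / (Q(θ_ob|θ_ob) − Q(θ0|θ_ob))` one has:
the denominator equals `(ℓ_ob(θ_ob) − ℓ_ob(θ0)) + KL(θ_ob:θ0)` and is strictly positive,
`0 < RI₁ ≤ 1`, and `RI₁ = 1` iff `f(ω|y,θ_ob) = f(ω|y,θ0)` for all `ω ∈ Ωy`. -/
theorem stmt_7 {Ω O Θ : Type*} [Fintype Ω]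
    (g : Ω → O) (y : O) (Ωy : Finset Ω) (hΩy : ∀ ω, ω ∈ Ωy ↔ g ω = y)
    (hne : Ωy.Nonempty)
    (f : Θ → Ω → ℝ) (hpos : ∀ θ ω, 0 < f θ ω)
    (fob : Θ → ℝ) (hfob : ∀ θ, fob θ = ∑ ω ∈ Ωy, f θ ω)
    (fcond : Θ → Ω → ℝ) (hfcond : ∀ θ ω, fcond θ ω = f θ ω / fob θ)
    (ℓob : Θ → ℝ) (hℓob : ∀ θ, ℓob θ = Real.log (fob θ))
    (Q : Θ → Θ → ℝ)
    (hQ : ∀ θ θ', Q θ θ' = ∑ ω ∈ Ωy, fcond θ' ω * Real.log (f θ ω))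
    (KL : Θ → Θ → ℝ)
    (hKL : ∀ θ θ', KL θ θ' = ∑ ω ∈ Ωy, fcond θ ω * Real.log (fcond θ ω / fcond θ' ω))
    (θob θ0 : Θ)
    (hMLE : ∀ θ, ℓob θ ≤ ℓob θob)
    (hlt : ℓob θ0 < ℓob θob)
    (RI₁ : ℝ) (hRI₁ : RI₁ = (ℓob θob - ℓob θ0) / (Q θob θob - Q θ0 θob)) :
    (Q θob θob - Q θ0 θob = (ℓob θob - ℓob θ0) + KL θob θ0) ∧
    0 < Q θob θob - Q θ0 θob ∧
    0 < RI₁ ∧ RI₁ ≤ 1 ∧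
    (RI₁ = 1 ↔ ∀ ω ∈ Ωy, fcond θob ω = fcond θ0 ω) := by
  have hfobpos : ∀ θ, 0 < fob θ := fun θ => by
    rw [hfob]; exact Finset.sum_pos (fun ω _ => hpos θ ω) hne
  have hcpos : ∀ θ ω, 0 < fcond θ ω := fun θ ω => by
    rw [hfcond]; exact div_pos (hpos θ ω) (hfobpos θ)
  have hsum : ∀ θ, ∑ ω ∈ Ωy, fcond θ ω = 1 := fun θ => by
    simp only [hfcond]
    rw [← Finset.sum_div, ← hfob]
    exact div_self (hfobpos θ).ne'
  have h1 : Q θob θob - Q θ0 θob = (ℓob θob - ℓob θ0) + KL θob θ0 := by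
    have e : ℓob θob - ℓob θ0 = ∑ ω ∈ Ωy, fcond θob ω * (ℓob θob - ℓob θ0) := by
      rw [← Finset.sum_mul, hsum, one_mul]
    rw [e, hQ, hQ, hKL, ← Finset.sum_sub_distrib, ← Finset.sum_add_distrib]
    refine Finset.sum_congr rfl fun ω _ => ?_
    rw [Real.log_div (hcpos _ _).ne' (hcpos _ _).ne', hfcond θ0,
      Real.log_div (hpos _ _).ne' (hfobpos _).ne', hℓob, hℓob]
    have e2 : Real.log (fcond θob ω) = Real.log (f θob ω) - Real.log (fob θob) := by
      rw [hfcond, Real.log_div (hpos _ _).ne' (hfobpos _).ne']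
    rw [e2]; ring
  have hstrict : ∀ p q : ℝ, 0 < p → 0 < q → p ≠ q → 0 < p * Real.log (p / q) - p + q := by
    intro p q hp hq hpq
    have h := Real.log_lt_sub_one_of_pos (div_pos hq hp)
      (fun h => hpq ((div_eq_one_iff_eq hp.ne').1 h).symm)
    rw [← inv_div p q, Real.log_inv, inv_div] at h
    have h' := mul_lt_mul_of_pos_left h hp
    have e : p * (q / p - 1) = q - p := by field_simp
    linarith
  have hnn : ∀ p q : ℝ, 0 < p → 0 < q → 0 ≤ p * Real.log (p / q) - p + q := by
    intro p q hp hq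
    by_cases h : p = q
    · subst h; simp [hp.ne']
    · exact (hstrict p q hp hq h).le
  have hKL' : KL θob θ0 = ∑ ω ∈ Ωy, (fcond θob ω * Real.log (fcond θob ω / fcond θ0 ω)
      - fcond θob ω + fcond θ0 ω) := by
    rw [Finset.sum_add_distrib, Finset.sum_sub_distrib, hsum, hsum, hKL]; ring
  have hK0 : 0 ≤ KL θob θ0 := by
    rw [hKL']; exact Finset.sum_nonneg fun ω _ => hnn _ _ (hcpos _ _) (hcpos _ _)
  have hKiff : KL θob θ0 = 0 ↔ ∀ ω ∈ Ωy, fcond θob ω = fcond θ0 ω := by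
    rw [hKL', Finset.sum_eq_zero_iff_of_nonneg
      fun ω _ => hnn _ _ (hcpos _ _) (hcpos _ _)]
    refine forall₂_congr fun ω _ => ⟨fun h => ?_, fun h => ?_⟩
    · by_contra hc
      exact (hstrict _ _ (hcpos _ _) (hcpos _ _) hc).ne' h
    · rw [h]; simp [(hcpos θ0 ω).ne']
  have hd : 0 < Q θob θob - Q θ0 θob := by rw [h1]; linarith
  refine ⟨h1, hd, ?_, ?_, ?_⟩
  · rw [hRI₁]; exact div_pos (by linarith) hd
  · rw [hRI₁, div_le_one hd]; linarith
  · rw [hRI₁, div_eq_one_iff_eq hd.ne', ← hKiff, h1]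
    constructor <;> intro h <;> linarith
end

section
/- In the Bayesian finite missing-data model, the expectation of the complete-data Bayes factor ω ↦ BF_co(ω) under the posterior predictive distribution f(ω|y), the expectation of the complete-data likelihood ratio (θ,ω) ↦ LR(θ0,θ|ω) under the joint posterior, and the expectation of the observed-data likelihood ratio θ ↦ LR(θ0,θ|y) under the posterior p(dθ|y) are all equal to the observed-data Bayes factor BF_ob. -/
open MeasureTheory

/-- in the Bayesian finite missing-data model, the posterior-predictive
mean of the complete-data Bayes factor `BF_co`, the joint-posterior mean of the
complete-data likelihood ratio `LR(θ0,θ|ω)`, and the posterior mean of the observed-data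
likelihood ratio `LR(θ0,θ|y)` are all equal to the observed-data Bayes factor `BF_ob`. -/
theorem stmt_11 {Ω O : Type*} [Fintype Ω] {Θ : Type*} [MeasurableSpace Θ]
    (g : Ω → O) (y : O) (Ωy : Finset Ω) (hΩy : ∀ ω, ω ∈ Ωy ↔ g ω = y)
    (hne : Ωy.Nonempty)
    (f : Θ → Ω → ℝ) (hpos : ∀ θ ω, 0 < f θ ω)
    (hmeas : ∀ ω, Measurable fun θ => f θ ω)
    (fob : Θ → ℝ) (hfob : ∀ θ, fob θ = ∑ ω ∈ Ωy, f θ ω)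
    (fcond : Θ → Ω → ℝ) (hfcond : ∀ θ ω, fcond θ ω = f θ ω / fob θ)
    (π : Measure Θ) [IsProbabilityMeasure π]
    (hintf : ∀ ω, Integrable (fun θ => f θ ω) π)
    (Z : ℝ) (hZ : Z = ∫ θ, fob θ ∂π) (hZpos : 0 < Z)
    (θ0 : Θ)
    (BFob : ℝ) (hBFob : BFob = fob θ0 / Z)
    (BFco : Ω → ℝ) (hBFco : ∀ ω, BFco ω = f θ0 ω / ∫ θ, f θ ω ∂π)
    -- posterior predictive pmf of the complete data
    (fpred : Ω → ℝ)
    (hfpred : ∀ ω, fpred ω = (∫ θ, fcond θ ω * fob θ ∂π) / Z) :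
    (∑ ω ∈ Ωy, fpred ω * BFco ω = BFob) ∧
    ((∫ θ, ∑ ω ∈ Ωy, f θ ω * (f θ0 ω / f θ ω) ∂π) / Z = BFob) ∧
    ((∫ θ, fob θ * (fob θ0 / fob θ) ∂π) / Z = BFob) := by
  have hfobpos : ∀ θ, 0 < fob θ := fun θ => by
    rw [hfob]
    exact Finset.sum_pos (fun ω _ => hpos θ ω) hne
  have hI : ∀ ω, 0 < ∫ θ, f θ ω ∂π := fun ω => by
    rw [integral_pos_iff_support_of_nonneg (fun θ => (hpos θ ω).le) (hintf ω)]
    have hs : Function.support (fun θ => f θ ω) = Set.univ :=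
      Set.eq_univ_of_forall fun θ => (hpos θ ω).ne'
    rw [hs, measure_univ]
    exact one_pos
  refine ⟨?_, ?_, ?_⟩
  · have key : ∀ ω ∈ Ωy, fpred ω * BFco ω = f θ0 ω / Z := fun ω _ => by
      have h : (fun θ => fcond θ ω * fob θ) = fun θ => f θ ω := by
        funext θ
        rw [hfcond, div_mul_cancel₀ _ (hfobpos θ).ne']
      rw [hfpred, hBFco, h]
      have h1 := (hI ω).ne'
      have h2 := hZpos.ne'
      field_simp
    rw [Finset.sum_congr rfl key, ← Finset.sum_div, hBFob, hfob]
  · have h : (fun θ => ∑ ω ∈ Ωy, f θ ω * (f θ0 ω / f θ ω)) = fun _ => fob θ0 := by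
      funext θ
      rw [hfob]
      exact Finset.sum_congr rfl fun ω _ => mul_div_cancel₀ _ (hpos θ ω).ne'
    rw [h, hBFob]
    simp
  · have h : (fun θ => fob θ * (fob θ0 / fob θ)) = fun _ => fob θ0 := by
      funext θ
      exact mul_div_cancel₀ _ (hfobpos θ).ne'
    rw [h, hBFob]
    simp
end

section
/- In the Bayesian finite missing-data model, assume the function (θ,ω) ↦ LR(θ0,θ|ω) is square-integrable with respect to the joint posterior. Then both the variance of ω ↦ BF_co(ω) under the posterior predictive distribution f(ω|y) and the variance of θ ↦ LR(θ0,θ|y) under the posterior p(dθ|y) are bounded above by the variance of (θ,ω) ↦ LR(θ0,θ|ω) under the joint posterior; that is, max{ Var[BF_co | Y_ob], Var[LR(θ0,θ|Y_ob) | Y_ob] } ≤ Var[LR(θ0,θ|Y_co) | Y_ob]. -/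
open MeasureTheory

/-- in the Bayesian finite missing-data model, with the complete-data
likelihood ratio square-integrable for the joint posterior, both the posterior-predictive
variance of the complete-data Bayes factor `BF_co` and the posterior variance of the
observed-data likelihood ratio are bounded by the joint-posterior variance of the
complete-data likelihood ratio:
`max{Var[BF_co|Y_ob], Var[LR(θ0,θ|Y_ob)|Y_ob]} ≤ Var[LR(θ0,θ|Y_co)|Y_ob]`. -/
theorem stmt_12 {Ω O : Type*} [Fintype Ω] {Θ : Type*} [MeasurableSpace Θ]
    (g : Ω → O) (y : O) (Ωy : Finset Ω) (hΩy : ∀ ω, ω ∈ Ωy ↔ g ω = y)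
    (hne : Ωy.Nonempty)
    (f : Θ → Ω → ℝ) (hpos : ∀ θ ω, 0 < f θ ω)
    (hmeas : ∀ ω, Measurable fun θ => f θ ω)
    (fob : Θ → ℝ) (hfob : ∀ θ, fob θ = ∑ ω ∈ Ωy, f θ ω)
    (fcond : Θ → Ω → ℝ) (hfcond : ∀ θ ω, fcond θ ω = f θ ω / fob θ)
    (π : Measure Θ) [IsProbabilityMeasure π]
    (hintf : ∀ ω, Integrable (fun θ => f θ ω) π)
    (Z : ℝ) (hZ : Z = ∫ θ, fob θ ∂π) (hZpos : 0 < Z)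
    (hint : Integrable fob π)
    (θ0 : Θ)
    -- square-integrability of the complete-data likelihood ratio w.r.t. the joint posterior
    (hsq : Integrable (fun θ => ∑ ω ∈ Ωy, f θ ω * (f θ0 ω / f θ ω) ^ 2) π)
    (BFco : Ω → ℝ) (hBFco : ∀ ω, BFco ω = f θ0 ω / ∫ θ, f θ ω ∂π)
    (fpred : Ω → ℝ)
    (hfpred : ∀ ω, fpred ω = (∫ θ, fcond θ ω * fob θ ∂π) / Z)
    -- predictive variance of the complete-data Bayes factor
    (Vpred : ℝ)
    (hVpred : Vpred = (∑ ω ∈ Ωy, fpred ω * BFco ω ^ 2) - (∑ ω ∈ Ωy, fpred ω * BFco ω) ^ 2)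
    -- posterior variance of the observed-data likelihood ratio
    (Vpost : ℝ)
    (hVpost : Vpost = (∫ θ, fob θ * (fob θ0 / fob θ) ^ 2 ∂π) / Z -
      ((∫ θ, fob θ * (fob θ0 / fob θ) ∂π) / Z) ^ 2)
    -- joint-posterior variance of the complete-data likelihood ratio
    (Vjoint : ℝ)
    (hVjoint : Vjoint = (∫ θ, ∑ ω ∈ Ωy, f θ ω * (f θ0 ω / f θ ω) ^ 2 ∂π) / Z -
      ((∫ θ, ∑ ω ∈ Ωy, f θ ω * (f θ0 ω / f θ ω) ∂π) / Z) ^ 2) :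
    max Vpred Vpost ≤ Vjoint := by
  have hZ0 := hZpos.ne'
  have hfobpos : ∀ θ, 0 < fob θ := fun θ => by
    rw [hfob]; exact Finset.sum_pos (fun ω _ => hpos θ ω) hne
  have hm : ∀ ω, 0 < ∫ θ, f θ ω ∂π := fun ω => by
    rw [integral_pos_iff_support_of_nonneg (fun θ => (hpos θ ω).le) (hintf ω)]
    have : Function.support (fun θ => f θ ω) = Set.univ := by
      ext θ; simp [(hpos θ ω).ne']
    rw [this]; simp
  have hpr : ∀ ω, fpred ω = (∫ θ, f θ ω ∂π) / Z := fun ω => by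
    rw [hfpred]
    congr 2
    funext θ
    rw [hfcond, div_mul_cancel₀ _ (hfobpos θ).ne']
  have e1 : ∑ ω ∈ Ωy, fpred ω * BFco ω = fob θ0 / Z := by
    rw [hfob, Finset.sum_div]
    refine Finset.sum_congr rfl fun ω _ => ?_
    rw [hpr, hBFco]
    have := (hm ω).ne'
    field_simp
  have e2 : ∫ θ, fob θ * (fob θ0 / fob θ) ∂π = fob θ0 := by
    have : (fun θ => fob θ * (fob θ0 / fob θ)) = fun _ => fob θ0 := by
      funext θ
      exact mul_div_cancel₀ _ (hfobpos θ).ne'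
    rw [this]; simp
  have e3 : ∫ θ, ∑ ω ∈ Ωy, f θ ω * (f θ0 ω / f θ ω) ∂π = fob θ0 := by
    have : (fun θ => ∑ ω ∈ Ωy, f θ ω * (f θ0 ω / f θ ω)) = fun _ => fob θ0 := by
      funext θ
      rw [hfob]
      exact Finset.sum_congr rfl fun ω _ => mul_div_cancel₀ _ (hpos θ ω).ne'
    rw [this]; simp
  have hnn : ∀ θ ω, 0 ≤ f θ ω * (f θ0 ω / f θ ω) ^ 2 := fun θ ω =>
    mul_nonneg (hpos θ ω).le (sq_nonneg _)
  have hI : ∀ ω ∈ Ωy, Integrable (fun θ => f θ ω * (f θ0 ω / f θ ω) ^ 2) π := by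
    intro ω hω
    refine hsq.mono' ?_ (Filter.Eventually.of_forall fun θ => ?_)
    · exact ((hmeas ω).mul (((hmeas ω).const_div _).pow_const 2)).aestronglyMeasurable
    · rw [Real.norm_of_nonneg (hnn θ ω)]
      exact Finset.single_le_sum (f := fun ω => f θ ω * (f θ0 ω / f θ ω) ^ 2)
        (fun ω _ => hnn θ ω) hω
  rw [hVpred, hVpost, hVjoint, e1, e2, e3]
  refine max_le (sub_le_sub_right ?_ _) (sub_le_sub_right ?_ _)
  · rw [integral_finsetSum _ hI, Finset.sum_div]
    refine Finset.sum_le_sum fun ω hω => ?_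
    rw [hpr, hBFco, div_mul_eq_mul_div]
    refine div_le_div_of_nonneg_right ?_ hZpos.le
    have hmω := hm ω
    have key : ∀ m : ℝ, 0 < m → ∀ θ,
        2 * (f θ0 ω ^ 2 / m) - (f θ0 ω ^ 2 / m ^ 2) * f θ ω
          ≤ f θ ω * (f θ0 ω / f θ ω) ^ 2 := by
      intro m hm0 θ
      have h1 := hpos θ ω
      have h2 : f θ ω * (f θ0 ω / f θ ω) ^ 2 -
          (2 * (f θ0 ω ^ 2 / m) - (f θ0 ω ^ 2 / m ^ 2) * f θ ω)
          = f θ ω * (f θ0 ω / f θ ω - f θ0 ω / m) ^ 2 := by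
        field_simp
        ring
      have h3 := mul_nonneg h1.le (sq_nonneg (f θ0 ω / f θ ω - f θ0 ω / m))
      linarith
    have hi := (hintf ω).const_mul (f θ0 ω ^ 2 / (∫ θ, f θ ω ∂π) ^ 2)
    have h := integral_mono ((integrable_const _).sub hi) (hI ω hω) (key _ hmω)
    refine le_trans (le_of_eq ?_) h
    simp only [Pi.sub_apply]
    rw [integral_sub (integrable_const _) hi, integral_const_mul (f θ0 ω ^ 2 / (∫ θ, f θ ω ∂π) ^ 2) (fun θ => f θ ω)]
    simp only [integral_const, probReal_univ, one_smul]
    field_simp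
    ring
  · refine div_le_div_of_nonneg_right ?_ hZpos.le
    refine integral_mono_of_nonneg
      (Filter.Eventually.of_forall fun θ => mul_nonneg (hfobpos θ).le (sq_nonneg _)) hsq
      (Filter.Eventually.of_forall fun θ => ?_)
    have h := Finset.sum_sq_le_sum_mul_sum_of_sq_eq_mul Ωy
      (r := fun ω => f θ0 ω) (f := fun ω => f θ ω)
      (g := fun ω => f θ ω * (f θ0 ω / f θ ω) ^ 2)
      (fun ω _ => (hpos θ ω).le) (fun ω _ => hnn θ ω)
      (fun ω _ => by have := (hpos θ ω).ne'; field_simp)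
    rw [← hfob, ← hfob] at h
    have h1 := hfobpos θ
    have h2 : fob θ * (fob θ0 / fob θ) ^ 2 = fob θ0 ^ 2 / fob θ := by field_simp
    change fob θ * (fob θ0 / fob θ) ^ 2 ≤ _
    rw [h2, div_le_iff₀ h1, mul_comm]
    exact h
end

section
/- In the Bayesian finite missing-data model, assume all relevant likelihood-ratio functions are square-integrable with respect to π and with respect to the joint posterior, and that the denominators below are nonzero. Then the Bayes information measure BI₁^π — the variance of θ ↦ LR(θ0,θ|y) under the posterior p(dθ|y) divided by the variance of (θ,ω) ↦ LR(θ0,θ|ω) under the joint posterior — admits the prior-covariance representation BI₁^π = Cov_π[ LR(θ0,θ|y), LR(θ,θ0|y) ] / Cov_{π,θ0}[ LR(θ0,θ|ω), LR(θ,θ0|ω) ], where Cov_π is the covariance of functions of θ under the prior π, and Cov_{π,θ0} is the covariance of functions of (θ,ω) under the product measure π(dθ) ⊗ f(ω|y,θ0). -/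
open MeasureTheory

/-- in the Bayesian finite missing-data model, the Bayes information
measure `BI₁^π` (posterior variance of the observed-data likelihood ratio divided by the
joint-posterior variance of the complete-data likelihood ratio) admits the
prior-covariance representation
`BI₁^π = Cov_π[LR(θ0,θ|y), LR(θ,θ0|y)] / Cov_{π,θ0}[LR(θ0,θ|ω), LR(θ,θ0|ω)]`,
where `Cov_π` is the covariance under the prior `π` and `Cov_{π,θ0}` the covariance under
`π(dθ) ⊗ f(ω|y,θ0)`. -/
theorem stmt_13 {Ω O : Type*} [Fintype Ω] {Θ : Type*} [MeasurableSpace Θ]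
    (g : Ω → O) (y : O) (Ωy : Finset Ω) (hΩy : ∀ ω, ω ∈ Ωy ↔ g ω = y)
    (hne : Ωy.Nonempty)
    (f : Θ → Ω → ℝ) (hpos : ∀ θ ω, 0 < f θ ω)
    (hmeas : ∀ ω, Measurable fun θ => f θ ω)
    (fob : Θ → ℝ) (hfob : ∀ θ, fob θ = ∑ ω ∈ Ωy, f θ ω)
    (fcond : Θ → Ω → ℝ) (hfcond : ∀ θ ω, fcond θ ω = f θ ω / fob θ)
    (π : Measure Θ) [IsProbabilityMeasure π]
    (Z : ℝ) (hZ : Z = ∫ θ, fob θ ∂π) (hZpos : 0 < Z)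
    (hint : Integrable fob π)
    (θ0 : Θ)
    -- square-integrability of the relevant likelihood-ratio functions
    (hsq1 : Integrable (fun θ => (fob θ0 / fob θ) ^ 2) π)
    (hsq2 : Integrable (fun θ => (fob θ / fob θ0) ^ 2) π)
    (hsq3 : Integrable (fun θ => ∑ ω ∈ Ωy, f θ ω * (f θ0 ω / f θ ω) ^ 2) π)
    (hsq4 : Integrable (fun θ => ∑ ω ∈ Ωy, fcond θ0 ω * (f θ0 ω / f θ ω) ^ 2) π)
    (hsq5 : Integrable (fun θ => ∑ ω ∈ Ωy, fcond θ0 ω * (f θ ω / f θ0 ω) ^ 2) π)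
    -- posterior variance of the observed-data likelihood ratio
    (Vpost : ℝ)
    (hVpost : Vpost = (∫ θ, fob θ * (fob θ0 / fob θ) ^ 2 ∂π) / Z -
      ((∫ θ, fob θ * (fob θ0 / fob θ) ∂π) / Z) ^ 2)
    -- joint-posterior variance of the complete-data likelihood ratio
    (Vjoint : ℝ)
    (hVjoint : Vjoint = (∫ θ, ∑ ω ∈ Ωy, f θ ω * (f θ0 ω / f θ ω) ^ 2 ∂π) / Z -
      ((∫ θ, ∑ ω ∈ Ωy, f θ ω * (f θ0 ω / f θ ω) ∂π) / Z) ^ 2)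
    -- prior covariance of the observed-data likelihood ratio and its reciprocal
    (Covπ : ℝ)
    (hCovπ : Covπ = (∫ θ, (fob θ0 / fob θ) * (fob θ / fob θ0) ∂π) -
      (∫ θ, fob θ0 / fob θ ∂π) * (∫ θ, fob θ / fob θ0 ∂π))
    -- covariance under π(dθ) ⊗ f(ω|y,θ0) of the complete-data likelihood ratio and its
    -- reciprocal
    (Covπθ0 : ℝ)
    (hCovπθ0 : Covπθ0 =
      (∫ θ, ∑ ω ∈ Ωy, fcond θ0 ω * ((f θ0 ω / f θ ω) * (f θ ω / f θ0 ω)) ∂π) -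
        (∫ θ, ∑ ω ∈ Ωy, fcond θ0 ω * (f θ0 ω / f θ ω) ∂π) *
          (∫ θ, ∑ ω ∈ Ωy, fcond θ0 ω * (f θ ω / f θ0 ω) ∂π))
    (hVjoint0 : Vjoint ≠ 0) (hCov0 : Covπθ0 ≠ 0) :
    Vpost / Vjoint = Covπ / Covπθ0 := by
  have hobpos : ∀ θ, 0 < fob θ := fun θ => by
    rw [hfob]; exact Finset.sum_pos (fun ω _ => hpos θ ω) hne
  have hc := hobpos θ0
  have e1 : (∫ θ, fob θ * (fob θ0 / fob θ) ^ 2 ∂π) = fob θ0 * ∫ θ, fob θ0 / fob θ ∂π := by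
    rw [← integral_const_mul]
    congr 1; funext θ
    have := (hobpos θ).ne'
    field_simp
  have e2 : (∫ θ, fob θ * (fob θ0 / fob θ) ∂π) = fob θ0 := by
    have : (fun θ => fob θ * (fob θ0 / fob θ)) = fun _ => fob θ0 := by
      funext θ
      have := (hobpos θ).ne'
      field_simp
    rw [this]; simp
  have e3 : (∫ θ, ∑ ω ∈ Ωy, f θ ω * (f θ0 ω / f θ ω) ∂π) = fob θ0 := by
    have : (fun θ => ∑ ω ∈ Ωy, f θ ω * (f θ0 ω / f θ ω)) = fun _ => fob θ0 := by
      funext θ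
      rw [hfob θ0]
      refine Finset.sum_congr rfl fun ω _ => ?_
      have := (hpos θ ω).ne'
      field_simp
    rw [this]; simp
  have e4 : (∫ θ, (fob θ0 / fob θ) * (fob θ / fob θ0) ∂π) = 1 := by
    have : (fun θ => (fob θ0 / fob θ) * (fob θ / fob θ0)) = fun _ => (1 : ℝ) := by
      funext θ
      have := (hobpos θ).ne'
      field_simp
    rw [this]; simp
  have e5 : (∫ θ, fob θ / fob θ0 ∂π) = Z / fob θ0 := by
    rw [integral_div, hZ]
  have e6 : (∫ θ, ∑ ω ∈ Ωy, fcond θ0 ω * ((f θ0 ω / f θ ω) * (f θ ω / f θ0 ω)) ∂π) = 1 := by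
    have : (fun θ => ∑ ω ∈ Ωy, fcond θ0 ω * ((f θ0 ω / f θ ω) * (f θ ω / f θ0 ω)))
        = fun _ => (1 : ℝ) := by
      funext θ
      have h1 : (1 : ℝ) = ∑ ω ∈ Ωy, f θ0 ω / fob θ0 := by
        rw [← Finset.sum_div, ← hfob, div_self hc.ne']
      rw [h1]
      refine Finset.sum_congr rfl fun ω _ => ?_
      have := (hpos θ ω).ne'
      have := (hpos θ0 ω).ne'
      rw [hfcond]
      field_simp
    rw [this]; simp
  have e7 : (∫ θ, ∑ ω ∈ Ωy, fcond θ0 ω * (f θ0 ω / f θ ω) ∂π)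
      = (∫ θ, ∑ ω ∈ Ωy, f θ ω * (f θ0 ω / f θ ω) ^ 2 ∂π) / fob θ0 := by
    rw [← integral_div]
    congr 1; funext θ
    rw [Finset.sum_div]
    refine Finset.sum_congr rfl fun ω _ => ?_
    have := (hpos θ ω).ne'
    rw [hfcond]
    field_simp
  have e8 : (∫ θ, ∑ ω ∈ Ωy, fcond θ0 ω * (f θ ω / f θ0 ω) ∂π) = Z / fob θ0 := by
    rw [hZ, ← integral_div]
    congr 1; funext θ
    rw [hfob θ, Finset.sum_div]
    refine Finset.sum_congr rfl fun ω _ => ?_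
    have := (hpos θ0 ω).ne'
    rw [hfcond]
    field_simp
  rw [e1, e2] at hVpost
  rw [e3] at hVjoint
  rw [e4, e5] at hCovπ
  rw [e6, e7, e8] at hCovπθ0
  have k1 : Vpost = -(fob θ0 / Z) ^ 2 * Covπ := by
    rw [hVpost, hCovπ]; field_simp; ring
  have k2 : Vjoint = -(fob θ0 / Z) ^ 2 * Covπθ0 := by
    rw [hVjoint, hCovπθ0]; field_simp; ring
  rw [k1, k2, mul_div_mul_left]
  have := div_pos hc hZpos
  exact neg_ne_zero.mpr (pow_ne_zero 2 this.ne')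
end

section
/- In the finite missing-data model with smooth parametrization, for every θ ∈ Θ and every integer k ≥ 0, the (k+1)-st derivative of the observed-data log-likelihood satisfies ℓ_ob^{(k+1)}(θ) = Σ_{j=0}^{k} C(k,j) · Q^{(j+1, k−j)}(θ|θ), where C(k,j) is the binomial coefficient and Q^{(i,j)}(θ1|θ2) = ∂^{i+j} Q(θ1|θ2) / ∂θ1^i ∂θ2^j. -/
/-- Meng's identity: in the finite missing-data model with smooth
parametrization, for every `θ ∈ Θ` and `k ≥ 0`,
`ℓ_ob^{(k+1)}(θ) = ∑_{j=0}^{k} C(k,j) Q^{(j+1,k−j)}(θ|θ)`, where `Q^{(i,j)}` denotes the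
mixed partial derivative of `Q(θ1|θ2)` of order `i` in `θ1` and `j` in `θ2`. -/
theorem stmt_14 {Ω O : Type*} [Fintype Ω]
    (g : Ω → O) (y : O) (Ωy : Finset Ω) (hΩy : ∀ ω, ω ∈ Ωy ↔ g ω = y)
    (hne : Ωy.Nonempty)
    (Θ : Set ℝ) (hΘopen : IsOpen Θ) (hΘconn : Θ.OrdConnected)
    (f : ℝ → Ω → ℝ)
    (hpos : ∀ θ ∈ Θ, ∀ ω, 0 < f θ ω)
    (hsum : ∀ θ ∈ Θ, ∑ ω, f θ ω = 1)
    (hsmooth : ∀ ω, ContDiffOn ℝ (⊤ : ℕ∞) (fun θ => f θ ω) Θ)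
    (fob : ℝ → ℝ) (hfob : ∀ θ, fob θ = ∑ ω ∈ Ωy, f θ ω)
    (fcond : ℝ → Ω → ℝ) (hfcond : ∀ θ ω, fcond θ ω = f θ ω / fob θ)
    (Q : ℝ → ℝ → ℝ)
    (hQ : ∀ θ θ', Q θ θ' = ∑ ω ∈ Ωy, fcond θ' ω * Real.log (f θ ω))
    -- `Qd i j a b` is the mixed partial derivative `Q^{(i,j)}(a|b)`
    (Qd : ℕ → ℕ → ℝ → ℝ → ℝ)
    (hQd : ∀ i j a b, Qd i j a b =
      iteratedDeriv i (fun t1 => iteratedDeriv j (fun t2 => Q t1 t2) b) a)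
    (θ : ℝ) (hθ : θ ∈ Θ) (k : ℕ) :
    iteratedDeriv (k + 1) (fun t => Real.log (fob t)) θ =
      ∑ j ∈ Finset.range (k + 1), (k.choose j : ℝ) * Qd (j + 1) (k - j) θ θ := by
  have hfobpos : ∀ t ∈ Θ, 0 < fob t := fun t ht => by
    rw [hfob]
    exact Finset.sum_pos (fun ω _ => hpos t ht ω) hne
  have hfobeq : fob = fun t => ∑ ω ∈ Ωy, f t ω := funext hfob
  have hfobS : ContDiffOn ℝ (⊤ : ℕ∞) fob Θ := by
    rw [hfobeq]
    exact ContDiffOn.sum fun ω _ => hsmooth ω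
  have hcS : ∀ ω, ContDiffOn ℝ (⊤ : ℕ∞) (fun t => fcond t ω) Θ := fun ω => by
    have h : (fun t => fcond t ω) = fun t => f t ω / fob t := funext fun t => hfcond t ω
    rw [h]
    exact (hsmooth ω).div hfobS fun t ht => (hfobpos t ht).ne'
  have hLS : ∀ ω, ContDiffOn ℝ (⊤ : ℕ∞) (fun t => Real.log (f t ω)) Θ := fun ω =>
    (hsmooth ω).log fun t ht => (hpos t ht ω).ne'
  have hdLS : ∀ ω, ContDiffOn ℝ (⊤ : ℕ∞) (deriv fun t => Real.log (f t ω)) Θ := fun ω =>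
    (hLS ω).deriv_of_isOpen hΘopen (by exact le_rfl)
  have hnhds : Θ ∈ nhds θ := hΘopen.mem_nhds hθ
  have at_ : ∀ {h : ℝ → ℝ}, ContDiffOn ℝ (⊤ : ℕ∞) h Θ → ∀ n : ℕ, ContDiffAt ℝ n h θ :=
    fun hh n => (hh.contDiffAt hnhds).of_le (by exact_mod_cast le_top)
  -- the mixed partial derivatives
  have hQd' : ∀ i j, Qd i j θ θ = ∑ ω ∈ Ωy,
      iteratedDeriv j (fun t => fcond t ω) θ *
        iteratedDeriv i (fun t => Real.log (f t ω)) θ := by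
    intro i j
    rw [hQd]
    have h1 : (fun t1 => iteratedDeriv j (fun t2 => Q t1 t2) θ) = fun t1 => ∑ ω ∈ Ωy,
        iteratedDeriv j (fun t => fcond t ω) θ * Real.log (f t1 ω) := by
      funext t1
      simp only [hQ]
      rw [iteratedDeriv_fun_sum fun ω _ => (at_ (hcS ω) j).mul contDiffAt_const]
      refine Finset.sum_congr rfl fun ω _ => ?_
      exact iteratedDeriv_mul_const_field (fun t => fcond t ω) _
    rw [h1, iteratedDeriv_fun_sum fun ω _ => contDiffAt_const.mul (at_ (hLS ω) i)]
    refine Finset.sum_congr rfl fun ω _ => ?_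
    exact iteratedDeriv_const_mul_field _ (fun t => Real.log (f t ω))
  -- Fisher's identity on `Θ`
  have hder : deriv (fun t => Real.log (fob t)) =ᶠ[nhds θ] fun t => ∑ ω ∈ Ωy,
      deriv (fun t => Real.log (f t ω)) t * fcond t ω := by
    filter_upwards [hnhds] with t ht
    have hd : ∀ ω, DifferentiableAt ℝ (fun t => f t ω) t := fun ω =>
      ((hsmooth ω).contDiffAt (hΘopen.mem_nhds ht)).differentiableAt (by simp)
    have hdo : HasDerivAt fob (∑ ω ∈ Ωy, deriv (fun t => f t ω) t) t := by
      rw [hfobeq]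
      exact HasDerivAt.fun_sum fun ω _ => (hd ω).hasDerivAt
    rw [(hdo.log (hfobpos t ht).ne').deriv, Finset.sum_div]
    refine Finset.sum_congr rfl fun ω _ => ?_
    rw [((hd ω).hasDerivAt.log (hpos t ht ω).ne').deriv, hfcond]
    have := (hpos t ht ω).ne'
    have := (hfobpos t ht).ne'
    field_simp
  rw [iteratedDeriv_succ', hder.iteratedDeriv_eq,
    iteratedDeriv_fun_sum fun ω _ => (at_ (hdLS ω) k).mul (at_ (hcS ω) k)]
  simp only [hQd', Finset.mul_sum]
  rw [Finset.sum_comm]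
  refine Finset.sum_congr rfl fun ω _ => ?_
  rw [iteratedDeriv_fun_mul (at_ (hdLS ω) k) (at_ (hcS ω) k)]
  refine Finset.sum_congr rfl fun j _ => ?_
  rw [iteratedDeriv_succ']
  ring
end

section
/- In the finite missing-data model with smooth parametrization, for every θ ∈ Θ the missing-information principle holds: I_co(θ) = I_ob(θ) + I_mi(θ), where I_ob(θ) = −ℓ_ob''(θ), I_co(θ) = −Q^{(2,0)}(θ|θ) = Σ_{ω∈Ω_y} f(ω|y,θ) · ( −∂²ℓ(θ'|ω)/∂θ'² |_{θ'=θ} ), and I_mi(θ) = Σ_{ω∈Ω_y} f(ω|y,θ) · ( −∂² log f(ω|y,θ')/∂θ'² |_{θ'=θ} ). -/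
/-- missing-information principle: in the finite missing-data model with
smooth parametrization, for every `θ ∈ Θ`, `I_co(θ) = I_ob(θ) + I_mi(θ)`, where
`I_ob(θ) = −ℓ_ob''(θ)`,
`I_co(θ) = −Q^{(2,0)}(θ|θ) = ∑_{ω∈Ωy} f(ω|y,θ)(−∂²ℓ(θ'|ω)/∂θ'²|_{θ'=θ})`, and
`I_mi(θ) = ∑_{ω∈Ωy} f(ω|y,θ)(−∂² log f(ω|y,θ')/∂θ'²|_{θ'=θ})`. -/
theorem stmt_15 {Ω O : Type*} [Fintype Ω]
    (g : Ω → O) (y : O) (Ωy : Finset Ω) (hΩy : ∀ ω, ω ∈ Ωy ↔ g ω = y)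
    (hne : Ωy.Nonempty)
    (Θ : Set ℝ) (hΘopen : IsOpen Θ) (hΘconn : Θ.OrdConnected)
    (f : ℝ → Ω → ℝ)
    (hpos : ∀ θ ∈ Θ, ∀ ω, 0 < f θ ω)
    (hsum : ∀ θ ∈ Θ, ∑ ω, f θ ω = 1)
    (hsmooth : ∀ ω, ContDiffOn ℝ (⊤ : ℕ∞) (fun θ => f θ ω) Θ)
    (fob : ℝ → ℝ) (hfob : ∀ θ, fob θ = ∑ ω ∈ Ωy, f θ ω)
    (fcond : ℝ → Ω → ℝ) (hfcond : ∀ θ ω, fcond θ ω = f θ ω / fob θ)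
    (Q : ℝ → ℝ → ℝ)
    (hQ : ∀ θ θ', Q θ θ' = ∑ ω ∈ Ωy, fcond θ' ω * Real.log (f θ ω))
    (Iob Ico Imi : ℝ → ℝ)
    (hIob : ∀ θ, Iob θ = -iteratedDeriv 2 (fun t => Real.log (fob t)) θ)
    (hIco : ∀ θ, Ico θ = -iteratedDeriv 2 (fun t => Q t θ) θ)
    (hImi : ∀ θ, Imi θ =
      ∑ ω ∈ Ωy, fcond θ ω * (-(iteratedDeriv 2 (fun t => Real.log (fcond t ω)) θ)))
    (θ : ℝ) (hθ : θ ∈ Θ) :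
    Ico θ = ∑ ω ∈ Ωy, fcond θ ω * (-(iteratedDeriv 2 (fun t => Real.log (f t ω)) θ)) ∧
    Ico θ = Iob θ + Imi θ := by
  have hca : ∀ ω, ContDiffAt ℝ 2 (fun t => f t ω) θ := fun ω =>
    (contDiffOn_infty.1 (hsmooth ω) 2).contDiffAt (hΘopen.mem_nhds hθ)
  have hobpos : ∀ t ∈ Θ, 0 < fob t := fun t ht => by
    rw [hfob]; exact Finset.sum_pos (fun ω _ => hpos t ht ω) hne
  have hobc : ContDiffAt ℝ 2 fob θ := by
    have : fob = fun t => ∑ ω ∈ Ωy, f t ω := funext hfob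
    rw [this]
    exact ContDiffAt.sum fun ω _ => hca ω
  have hl : ∀ ω, ContDiffAt ℝ 2 (fun t => Real.log (f t ω)) θ := fun ω =>
    (hca ω).log (hpos θ hθ ω).ne'
  have hlob : ContDiffAt ℝ 2 (fun t => Real.log (fob t)) θ := hobc.log (hobpos θ hθ).ne'
  have h1 : Ico θ = ∑ ω ∈ Ωy,
      fcond θ ω * (-(iteratedDeriv 2 (fun t => Real.log (f t ω)) θ)) := by
    rw [hIco]
    simp only [hQ]
    rw [iteratedDeriv_fun_sum (fun ω _ => contDiffAt_const.mul (hl ω)), ← Finset.sum_neg_distrib]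
    refine Finset.sum_congr rfl fun ω _ => ?_
    rw [iteratedDeriv_const_mul_field]
    ring
  refine ⟨h1, ?_⟩
  have h2 : ∀ ω, iteratedDeriv 2 (fun t => Real.log (fcond t ω)) θ =
      iteratedDeriv 2 (fun t => Real.log (f t ω)) θ
        - iteratedDeriv 2 (fun t => Real.log (fob t)) θ := by
    intro ω
    rw [← iteratedDeriv_fun_sub (hl ω) hlob]
    apply Filter.EventuallyEq.iteratedDeriv_eq
    filter_upwards [hΘopen.mem_nhds hθ] with t ht
    rw [hfcond, Real.log_div (hpos t ht ω).ne' (hobpos t ht).ne']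
  have h3 : ∑ ω ∈ Ωy, fcond θ ω = 1 := by
    simp only [hfcond]
    rw [← Finset.sum_div, ← hfob, div_self (hobpos θ hθ).ne']
  rw [h1, hIob, hImi]
  simp only [h2, neg_sub, mul_sub, Finset.sum_sub_distrib, ← Finset.sum_mul, h3, mul_neg,
    Finset.sum_neg_distrib]
  ring
end

section
/- In the abstract EM decomposition, define for θ0 ∈ U with Q(θ_ob|θ_ob) ≠ Q(θ0|θ_ob) the relative information RI₁(θ0) = (ℓ(θ_ob) − ℓ(θ0)) / (Q(θ_ob|θ_ob) − Q(θ0|θ_ob)). Then, writing δ = θ0 − θ_ob, as δ → 0 one has the expansion RI₁(θ0) = RI_E + ((Q^{(3,0)}_ob · RI_E − ℓ^{(3)}(θ_ob)) / (3 I_co)) · δ + O(δ²), where Q^{(3,0)}_ob = ∂³Q(θ1|θ2)/∂θ1³ evaluated at θ1 = θ2 = θ_ob. -/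
theorem taylor_aux (U : Set ℝ) (hUopen : IsOpen U) (hUconn : U.OrdConnected)
    (f : ℝ → ℝ) (hf : ContDiffOn ℝ 4 f U) (x : ℝ) (hx : x ∈ U) (hc : deriv f x = 0) :
    ∃ M ε : ℝ, 0 ≤ M ∧ 0 < ε ∧ ∀ δ : ℝ, |δ| < ε → x + δ ∈ U ∧
      |f (x + δ) - f x - iteratedDeriv 2 f x / 2 * δ ^ 2 - iteratedDeriv 3 f x / 6 * δ ^ 3|
        ≤ M * δ ^ 4 := by
  have h := taylor_isLittleO (n := 4) hUconn.convex hx hf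
  rw [hUopen.nhdsWithin_eq hx] at h
  have h1 := (h.bound (c := 1) one_pos).and (hUopen.mem_nhds hx)
  obtain ⟨ε, hε, hb⟩ := Metric.eventually_nhds_iff.1 h1
  refine ⟨1 + |iteratedDeriv 4 f x / 24|, ε, by positivity, hε, fun δ hδ => ?_⟩
  obtain ⟨hb1, hb2⟩ := hb (y := x + δ) (by simpa [Real.dist_eq] using hδ)
  refine ⟨hb2, ?_⟩
  have e : ∀ k, iteratedDerivWithin k f U x = iteratedDeriv k f x := fun k =>
    iteratedDerivWithin_of_isOpen hUopen hx
  simp only [taylorWithinEval_succ, taylor_within_zero_eval, e, iteratedDeriv_one, hc,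
    zero_add, Real.norm_eq_abs, add_sub_cancel_left, smul_eq_mul, one_mul] at hb1
  norm_num [Nat.factorial, hc] at hb1
  have p4 : |δ| ^ 4 = δ ^ 4 := by
    rw [← abs_pow]; exact abs_of_nonneg (by positivity)
  rw [p4] at hb1
  have h4 : |iteratedDeriv 4 f x / 24 * δ ^ 4| = |iteratedDeriv 4 f x / 24| * δ ^ 4 := by
    rw [abs_mul, abs_of_nonneg (by positivity : 0 ≤ δ ^ 4)]
  rw [add_mul, ← h4, one_mul]
  refine le_trans ?_ (add_le_add_left hb1 _)
  refine le_trans (le_of_eq ?_) (abs_add_le _ _)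
  congr 1
  ring


set_option maxHeartbeats 1000000 in
/-- in the abstract EM decomposition `Q(θ|θ') = ℓ(θ) + H(θ|θ')` with
`ℓ'(θ_ob) = 0`, `I_ob = −ℓ''(θ_ob) > 0`, `I_co = −Q^{(2,0)}(θ_ob|θ_ob) > 0` and
`RI_E = I_ob/I_co`, the relative information
`RI₁(θ0) = (ℓ(θ_ob) − ℓ(θ0))/(Q(θ_ob|θ_ob) − Q(θ0|θ_ob))` satisfies, with
`δ = θ0 − θ_ob → 0`,
`RI₁ = RI_E + ((Q^{(3,0)}_ob RI_E − ℓ^{(3)}(θ_ob))/(3 I_co)) δ + O(δ²)`. -/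
theorem stmt_16 (U : Set ℝ) (hUopen : IsOpen U) (hUconn : U.OrdConnected)
    (ℓ : ℝ → ℝ) (H : ℝ → ℝ → ℝ)
    (hℓ : ContDiffOn ℝ 4 ℓ U)
    (hH : ContDiffOn ℝ 4 (fun p : ℝ × ℝ => H p.1 p.2) (U ×ˢ U))
    (hstat : ∀ θ' ∈ U, deriv (fun t => H t θ') θ' = 0)
    (Q : ℝ → ℝ → ℝ) (hQ : ∀ t1 t2, Q t1 t2 = ℓ t1 + H t1 t2)
    (θob : ℝ) (hθob : θob ∈ U)
    (hcrit : deriv ℓ θob = 0)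
    (Iob : ℝ) (hIobdef : Iob = -iteratedDeriv 2 ℓ θob) (hIob : 0 < Iob)
    (Ico : ℝ) (hIcodef : Ico = -iteratedDeriv 2 (fun t => Q t θob) θob) (hIco : 0 < Ico)
    (RIE : ℝ) (hRIE : RIE = Iob / Ico)
    (Q30 : ℝ) (hQ30 : Q30 = iteratedDeriv 3 (fun t => Q t θob) θob) :
    ∃ C ε : ℝ, 0 < ε ∧ (∀ δ : ℝ, |δ| < ε → θob + δ ∈ U) ∧
      ∀ δ : ℝ, δ ≠ 0 → |δ| < ε →
        Q θob θob - Q (θob + δ) θob ≠ 0 ∧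
        |(ℓ θob - ℓ (θob + δ)) / (Q θob θob - Q (θob + δ) θob) -
            (RIE + ((Q30 * RIE - iteratedDeriv 3 ℓ θob) / (3 * Ico)) * δ)| ≤
          C * δ ^ 2 := by
  have hq : (fun t => Q t θob) = fun t => ℓ t + H t θob := funext fun t => hQ t θob
  have hHs : ContDiffOn ℝ 4 (fun t => H t θob) U :=
    hH.comp (f := fun t : ℝ => (t, θob)) (by fun_prop) (fun t ht => ⟨ht, hθob⟩)
  have hQs : ContDiffOn ℝ 4 (fun t => Q t θob) U := by
    rw [hq]; exact hℓ.add hHs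
  have hQc : deriv (fun t => Q t θob) θob = 0 := by
    have hd1 : DifferentiableAt ℝ ℓ θob :=
      (hℓ.contDiffAt (hUopen.mem_nhds hθob)).differentiableAt (by norm_num)
    have hd2 : DifferentiableAt ℝ (fun t => H t θob) θob :=
      (hHs.contDiffAt (hUopen.mem_nhds hθob)).differentiableAt (by norm_num)
    rw [hq, deriv_fun_add hd1 hd2, hcrit, hstat θob hθob, add_zero]
  obtain ⟨M1, ε1, hM1, hε1, h1⟩ := taylor_aux U hUopen hUconn ℓ hℓ θob hθob hcrit
  obtain ⟨M2, ε2, hM2, hε2, h2⟩ := taylor_aux U hUopen hUconn _ hQs θob hθob hQc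
  rw [← hQ30] at h2
  have e1 : iteratedDeriv 2 ℓ θob = -Iob := by linarith
  have e2 : iteratedDeriv 2 (fun t => Q t θob) θob = -Ico := by linarith
  rw [e1] at h1
  rw [e2] at h2
  generalize iteratedDeriv 3 ℓ θob = L3 at *
  set k := (Q30 * RIE - L3) / (3 * Ico) with hk
  have hk' : k * Ico = (Q30 * RIE - L3) / 3 := by rw [hk]; field_simp
  have hR' : RIE * Ico = Iob := by rw [hRIE]; field_simp
  set B := |Q30| / 6 + M2 + 1 with hB
  have hBpos : 0 < B := by positivity
  refine ⟨(|k * Q30 / 6| + M1 + (|RIE| + |k|) * M2) / (Ico / 4),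
    min (min ε1 ε2) (min 1 (Ico / (4 * B))), by positivity, fun δ hδ => ?_, fun δ hδ0 hδ => ?_⟩
  · exact (h1 δ (lt_of_lt_of_le hδ ((min_le_left _ _).trans (min_le_left _ _)))).1
  simp only [lt_min_iff] at hδ
  obtain ⟨⟨hd1, hd2⟩, hd3, hd4⟩ := hδ
  have t1 := (h1 δ hd1).2
  have t2 := (h2 δ hd2).2
  have hsq : 0 < δ ^ 2 := by positivity
  set r := ℓ (θob + δ) - ℓ θob - -Iob / 2 * δ ^ 2 - L3 / 6 * δ ^ 3 with hr
  set s := Q (θob + δ) θob - Q θob θob - -Ico / 2 * δ ^ 2 - Q30 / 6 * δ ^ 3 with hs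
  set N := ℓ θob - ℓ (θob + δ) with hN
  set D := Q θob θob - Q (θob + δ) θob with hD
  have hNe : N = Iob / 2 * δ ^ 2 - L3 / 6 * δ ^ 3 - r := by rw [hr]; ring
  have hDe : D = Ico / 2 * δ ^ 2 - Q30 / 6 * δ ^ 3 - s := by rw [hs]; ring
  have hδB : B * |δ| ≤ Ico / 4 := by
    rw [lt_div_iff₀ (by positivity)] at hd4; linarith
  have habs : δ ^ 2 = |δ| ^ 2 := (sq_abs δ).symm
  have hδ2 : δ ^ 2 ≤ |δ| := by
    rw [habs]; nlinarith [abs_nonneg δ]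
  have hDlow : Ico / 4 * δ ^ 2 ≤ D := by
    have a1 : Q30 / 6 * δ ≤ |Q30| / 6 * |δ| := by
      have := le_abs_self (Q30 * δ)
      rw [abs_mul] at this
      linarith
    have a2 : s ≤ M2 * δ ^ 4 := (le_abs_self _).trans t2
    have a3 : M2 * δ ^ 2 ≤ M2 * |δ| := mul_le_mul_of_nonneg_left hδ2 hM2
    have a4 : Q30 / 6 * δ + M2 * δ ^ 2 ≤ Ico / 4 := by
      rw [hB] at hδB
      linarith [abs_nonneg δ]
    have a5 := mul_le_mul_of_nonneg_right a4 hsq.le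
    rw [hDe]
    linarith [a5, a2]
  have hDpos : 0 < D := lt_of_lt_of_le (by positivity) hDlow
  refine ⟨hDpos.ne', ?_⟩
  have hE : N - (RIE + k * δ) * D = k * Q30 / 6 * δ ^ 4 - r + (RIE + k * δ) * s := by
    rw [hNe, hDe]
    linear_combination (-(1/2) * δ ^ 2) * hR' - (1/2) * δ ^ 3 * hk'
  have hd : N / D - (RIE + k * δ) = (N - (RIE + k * δ) * D) / D := by
    field_simp
  rw [hd, hE, abs_div, abs_of_pos hDpos, div_le_iff₀ hDpos]
  have hK : |RIE + k * δ| ≤ |RIE| + |k| := by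
    refine (abs_add_le _ _).trans ?_
    rw [abs_mul]
    linarith [mul_le_mul_of_nonneg_left hd3.le (abs_nonneg k)]
  have hnum : |k * Q30 / 6 * δ ^ 4 - r + (RIE + k * δ) * s| ≤
      (|k * Q30 / 6| + M1 + (|RIE| + |k|) * M2) * δ ^ 4 := by
    refine (abs_add_le _ _).trans ?_
    have b1 := abs_sub (k * Q30 / 6 * δ ^ 4) r
    have b2 : |k * Q30 / 6 * δ ^ 4| = |k * Q30 / 6| * δ ^ 4 := by
      rw [abs_mul, abs_of_nonneg (by positivity : 0 ≤ δ ^ 4)]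
    have b3 : |(RIE + k * δ) * s| ≤ (|RIE| + |k|) * (M2 * δ ^ 4) := by
      rw [abs_mul]
      exact mul_le_mul hK t2 (abs_nonneg _) (by positivity)
    linarith
  refine hnum.trans ?_
  set A := |k * Q30 / 6| + M1 + (|RIE| + |k|) * M2 with hA
  have hA0 : 0 ≤ A := by positivity
  calc A * δ ^ 4 = A / (Ico / 4) * δ ^ 2 * (Ico / 4 * δ ^ 2) := by field_simp
    _ ≤ A / (Ico / 4) * δ ^ 2 * D := by gcongr
end

section
/- In the abstract EM decomposition, assume additionally that −H^{(2,0)}(θ'|θ') > 0 for all θ' in a neighborhood of θ_ob, and that for each θ0 ∈ U the function θ ↦ Q(θ|θ0) has a unique stationary point θ_Q(θ0) in U, at which it attains its maximum. Then there exists ε > 0 such that for every θ0 with 0 < |θ0 − θ_ob| < ε, the derivatives Q^{(1,0)}(θ0|θ0) and Q^{(1,0)}(θ_ob|θ0) have strictly opposite signs, and consequently θ_Q(θ0) lies strictly between θ_ob and θ0; in particular |θ_Q(θ0) − θ_ob| < |θ0 − θ_ob|. -/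
open Topology

/-- A function vanishing at `x` with positive derivative has the sign of `y - x` nearby. -/
lemma sign_near {f : ℝ → ℝ} {f' x : ℝ} (h : HasDerivAt f f' x) (h0 : f x = 0) (hp : 0 < f') :
    ∀ᶠ y in 𝓝 x, y ≠ x → 0 < f y * (y - x) := by
  have h1 := (hasDerivAt_iff_tendsto_slope.1 h).eventually (lt_mem_nhds hp)
  rw [eventually_nhdsWithin_iff] at h1
  filter_upwards [h1] with y hy hne
  have h2 := hy hne
  rw [slope_def_field, h0, sub_zero] at h2
  have h3 : y - x ≠ 0 := sub_ne_zero.2 hne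
  have h4 : 0 < (y - x) ^ 2 := by positivity
  have h5 : f y * (y - x) = f y / (y - x) * (y - x) ^ 2 := by field_simp
  rw [h5]
  exact mul_pos h2 h4

/-- in the abstract EM decomposition, if additionally
`−H^{(2,0)}(θ'|θ') > 0` for `θ'` in a neighborhood of `θ_ob`, and for each `θ0` the map
`θ ↦ Q(θ|θ0)` has a unique stationary point `θ_Q(θ0)` in `U` at which it is maximal, then
there is `ε > 0` such that for `0 < |θ0 − θ_ob| < ε` the derivatives `Q^{(1,0)}(θ0|θ0)`
and `Q^{(1,0)}(θ_ob|θ0)` have strictly opposite signs, and `θ_Q(θ0)` lies strictly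
between `θ_ob` and `θ0`; in particular `|θ_Q(θ0) − θ_ob| < |θ0 − θ_ob|`. -/
theorem stmt_17 (U : Set ℝ) (hUopen : IsOpen U) (hUconn : U.OrdConnected)
    (ℓ : ℝ → ℝ) (H : ℝ → ℝ → ℝ)
    (hℓ : ContDiffOn ℝ 4 ℓ U)
    (hH : ContDiffOn ℝ 4 (fun p : ℝ × ℝ => H p.1 p.2) (U ×ˢ U))
    (hstat : ∀ θ' ∈ U, deriv (fun t => H t θ') θ' = 0)
    (Q : ℝ → ℝ → ℝ) (hQ : ∀ t1 t2, Q t1 t2 = ℓ t1 + H t1 t2)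
    (θob : ℝ) (hθob : θob ∈ U)
    (hcrit : deriv ℓ θob = 0)
    (Iob : ℝ) (hIobdef : Iob = -iteratedDeriv 2 ℓ θob) (hIob : 0 < Iob)
    (Ico : ℝ) (hIcodef : Ico = -iteratedDeriv 2 (fun t => Q t θob) θob) (hIco : 0 < Ico)
    (V : Set ℝ) (hV : V ∈ 𝓝 θob)
    (hHneg : ∀ θ' ∈ V, 0 < -iteratedDeriv 2 (fun t => H t θ') θ')
    (θQ : ℝ → ℝ)
    (hθQ : ∀ θ0 ∈ U, θQ θ0 ∈ U ∧ deriv (fun t => Q t θ0) (θQ θ0) = 0 ∧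
      (∀ t ∈ U, deriv (fun t' => Q t' θ0) t = 0 → t = θQ θ0) ∧
      (∀ t ∈ U, Q t θ0 ≤ Q (θQ θ0) θ0)) :
    ∃ ε : ℝ, 0 < ε ∧ ∀ θ0 ∈ U, θ0 ≠ θob → |θ0 - θob| < ε →
      (deriv (fun t => Q t θ0) θ0) * (deriv (fun t => Q t θ0) θob) < 0 ∧
      θQ θ0 ∈ Set.Ioo (min θob θ0) (max θob θ0) ∧
      |θQ θ0 - θob| < |θ0 - θob| := by
  have hUU : IsOpen (U ×ˢ U) := hUopen.prod hUopen
  set F : ℝ × ℝ → ℝ := fun p => H p.1 p.2 with hF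
  have hdℓ : ∀ s ∈ U, DifferentiableAt ℝ ℓ s := fun s hs =>
    (hℓ.differentiableOn (by norm_num)).differentiableAt (hUopen.mem_nhds hs)
  have hdF : ∀ p ∈ U ×ˢ U, DifferentiableAt ℝ F p := fun p hp =>
    (hH.differentiableOn (by norm_num)).differentiableAt (hUU.mem_nhds hp)
  have hpart : ∀ s ∈ U, ∀ t ∈ U, HasDerivAt (fun u => H u t) (fderiv ℝ F (s, t) (1, 0)) s := by
    intro s hs t ht
    have h1 : HasDerivAt (fun u : ℝ => (u, t)) ((1 : ℝ), (0 : ℝ)) s :=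
      (hasDerivAt_id s).prodMk (hasDerivAt_const s t)
    exact (hdF (s, t) ⟨hs, ht⟩).hasFDerivAt.comp_hasDerivAt s h1
  have hQd : ∀ s ∈ U, ∀ t ∈ U, deriv (fun u => Q u t) s
      = deriv ℓ s + fderiv ℝ F (s, t) (1, 0) := by
    intro s hs t ht
    have h1 : (fun u => Q u t) = fun u => ℓ u + H u t := by
      funext u
      exact hQ u t
    rw [h1]
    exact ((hdℓ s hs).hasDerivAt.add (hpart s hs t ht)).deriv
  set g : ℝ × ℝ → ℝ := fun p => fderiv ℝ F p (1, 0) with hg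
  have hfd : ContDiffOn ℝ 3 (fderiv ℝ F) (U ×ˢ U) :=
    hH.fderiv_of_isOpen hUU (by norm_num)
  have hgc : ContDiffOn ℝ 3 g (U ×ˢ U) := hfd.clm_apply contDiffOn_const
  have hgd : DifferentiableAt ℝ g (θob, θob) :=
    (hgc.differentiableOn (by norm_num)).differentiableAt (hUU.mem_nhds ⟨hθob, hθob⟩)
  have hgdiag : ∀ t ∈ U, g (t, t) = 0 := by
    intro t ht
    rw [← hstat t ht]
    exact (hpart t ht t ht).deriv.symm
  set L := fderiv ℝ g (θob, θob) with hL
  have hL1 : HasDerivAt (fun t => g (t, t)) (L (1, 1)) θob :=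
    hgd.hasFDerivAt.comp_hasDerivAt θob
      (f := fun t : ℝ => (t, t)) ((hasDerivAt_id θob).prodMk (hasDerivAt_id θob))
  have hL2 : HasDerivAt (fun t => g (t, θob)) (L (1, 0)) θob :=
    hgd.hasFDerivAt.comp_hasDerivAt θob
      (f := fun t : ℝ => (t, θob)) ((hasDerivAt_id θob).prodMk (hasDerivAt_const θob θob))
  have hL3 : HasDerivAt (fun t => g (θob, t)) (L (0, 1)) θob :=
    hgd.hasFDerivAt.comp_hasDerivAt θob
      (f := fun t : ℝ => (θob, t)) ((hasDerivAt_const θob θob).prodMk (hasDerivAt_id θob))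
  have hL1z : L (1, 1) = 0 := by
    have h1 : (fun t => g (t, t)) =ᶠ[𝓝 θob] fun _ => (0 : ℝ) := by
      filter_upwards [hUopen.mem_nhds hθob] with t ht using hgdiag t ht
    exact hL1.unique ((hasDerivAt_const θob (0 : ℝ)).congr_of_eventuallyEq h1)
  have hL2n : L (1, 0) < 0 := by
    have h1 := hHneg θob (mem_of_mem_nhds hV)
    have h2 : deriv (fun t => H t θob) =ᶠ[𝓝 θob] fun t => g (t, θob) := by
      filter_upwards [hUopen.mem_nhds hθob] with t ht using (hpart t ht θob hθob).deriv
    rw [iteratedDeriv_succ, iteratedDeriv_one, h2.deriv_eq, hL2.deriv] at h1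
    linarith
  have hL3p : 0 < L (0, 1) := by
    have h1 : L (1, 1) = L (1, 0) + L (0, 1) := by
      rw [← map_add]
      simp
    linarith
  have hℓ2 : HasDerivAt (fun t => - deriv ℓ t) Iob θob := by
    have h1 : ContDiffOn ℝ 3 (deriv ℓ) U := hℓ.deriv_of_isOpen hUopen (by norm_num)
    have h2 : DifferentiableAt ℝ (deriv ℓ) θob :=
      (h1.differentiableOn (by norm_num)).differentiableAt (hUopen.mem_nhds hθob)
    rw [hIobdef, iteratedDeriv_succ, iteratedDeriv_one]
    exact h2.hasDerivAt.neg
  have hs1 := sign_near hℓ2 (by simp [hcrit]) hIob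
  have hs2 := sign_near hL3 (hgdiag θob hθob) hL3p
  obtain ⟨ε, hε, hball⟩ := Metric.eventually_nhds_iff.1 (hs1.and hs2)
  refine ⟨ε, hε, fun θ0 h0 hne hlt => ?_⟩
  obtain ⟨ha, hb⟩ := hball (y := θ0) (by rwa [Real.dist_eq])
  have ha := ha hne
  have hb := hb hne
  have e1 : deriv (fun t => Q t θ0) θ0 = deriv ℓ θ0 := by
    rw [hQd θ0 h0 θ0 h0]
    have := hgdiag θ0 h0
    simp only [hg] at this
    rw [this, add_zero]
  have e2 : deriv (fun t => Q t θ0) θob = g (θob, θ0) := by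
    rw [hQd θob hθob θ0 h0, hcrit, zero_add]
  have hprod : (deriv (fun t => Q t θ0) θ0) * (deriv (fun t => Q t θ0) θob) < 0 := by
    rw [e1, e2]
    have h1 := mul_pos ha hb
    have h2 : 0 ≤ (θ0 - θob) ^ 2 := sq_nonneg _
    by_contra h3
    push Not at h3
    nlinarith [mul_nonneg h3 h2]
  have hcont : ContinuousOn (deriv (fun t => Q t θ0)) U := by
    have h1 : ContDiffOn ℝ 4 (fun t => Q t θ0) U := by
      have h2 : ContDiffOn ℝ 4 (fun t => F (t, θ0)) U :=
        hH.comp (contDiffOn_id.prodMk contDiffOn_const) (fun t ht => ⟨ht, h0⟩)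
      have h3 : (fun u => Q u θ0) = fun u => ℓ u + F (u, θ0) := by
        funext u
        exact hQ u θ0
      rw [h3]
      exact hℓ.add h2
    exact h1.continuousOn_deriv_of_isOpen hUopen (by norm_num)
  have hsub : Set.uIcc θob θ0 ⊆ U := hUconn.uIcc_subset hθob h0
  have hz : (0 : ℝ) ∈ Set.uIcc (deriv (fun t => Q t θ0) θob) (deriv (fun t => Q t θ0) θ0) := by
    rw [Set.mem_uIcc]
    rcases mul_neg_iff.1 hprod with ⟨h1, h2⟩ | ⟨h1, h2⟩
    · exact Or.inl ⟨h2.le, h1.le⟩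
    · exact Or.inr ⟨h1.le, h2.le⟩
  obtain ⟨z, hzm, hz0⟩ := intermediate_value_uIcc (hcont.mono hsub) hz
  have hzQ := (hθQ θ0 h0).2.2.1 z (hsub hzm) hz0
  have hz1 : z ≠ θob := by
    rintro rfl
    rw [hz0, mul_zero] at hprod
    exact lt_irrefl _ hprod
  have hz2 : z ≠ θ0 := by
    rintro rfl
    rw [hz0, zero_mul] at hprod
    exact lt_irrefl _ hprod
  rw [← hzQ]
  refine ⟨hprod, ?_⟩
  rcases lt_or_gt_of_ne hne with h | h
  · rw [Set.uIcc_of_ge h.le] at hzm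
    have a1 := lt_of_le_of_ne hzm.1 hz2.symm
    have a2 := lt_of_le_of_ne hzm.2 hz1
    rw [min_eq_right h.le, max_eq_left h.le, abs_of_neg (by linarith), abs_of_neg (by linarith)]
    exact ⟨⟨a1, a2⟩, by linarith⟩
  · rw [Set.uIcc_of_le h.le] at hzm
    have a1 := lt_of_le_of_ne hzm.1 hz1.symm
    have a2 := lt_of_le_of_ne hzm.2 hz2
    rw [min_eq_left h.le, max_eq_right h.le, abs_of_pos (by linarith), abs_of_pos (by linarith)]
    exact ⟨⟨a1, a2⟩, by linarith⟩
end
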